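/- arXiv:2109.02932 — 5 statements merged into one kernel-verified Lean document; each statement's English description precedes it below -/
import Mathlib

section
/- Let f ∈ ℤ[X] be a nonzero polynomial of degree n ≥ 1 with content c. Then the Hermite form [f] ∈ ℂ[X₁,…,X_n] has integer coefficients, i.e. [f] is the image under the coefficient embedding ℤ → ℂ of a (unique) polynomial F ∈ ℤ[X₁,…,X_n], and the content of F equals c^(n−1). -/
open Polynomial

/-- The Hermite form `[f]` of an integer polynomial viewed as degree `n`:
`f₀^(n-1) · ∏ᵢ (αᵢ^(n-1) X₁ + αᵢ^(n-2) X₂ + ⋯ + X_n)`, where the `αᵢ` are the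
complex roots of `f` counted with multiplicity. -/
noncomputable def hermiteForm (n : ℕ) (f : Polynomial ℤ) : MvPolynomial (Fin n) ℂ :=
  MvPolynomial.C ((f.leadingCoeff : ℂ) ^ (n - 1)) *
    (Multiset.map
      (fun α : ℂ => ∑ j : Fin n, MvPolynomial.C (α ^ (n - 1 - (j : ℕ))) * MvPolynomial.X j)
      ((f.map (Int.castRingHom ℂ)).roots)).prod

/-- `f` and `g`, viewed as degree-`n` polynomials, are Hermite equivalent if there are
`U ∈ GL_n(ℤ)` and `ε ∈ {1,-1}` with `[g](U·X) = ε·[f](X)`. -/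
def HermiteEquiv (n : ℕ) (f g : Polynomial ℤ) : Prop :=
  ∃ (U : Matrix (Fin n) (Fin n) ℤ) (ε : ℤ), IsUnit U.det ∧ (ε = 1 ∨ ε = -1) ∧
    MvPolynomial.bind₁
        (fun i : Fin n => ∑ j : Fin n, MvPolynomial.C ((U i j : ℂ)) * MvPolynomial.X j)
        (hermiteForm n g)
      = MvPolynomial.C ((ε : ℂ)) * hermiteForm n f

/-- The translate `(f∘M)(X) = ∑ₖ f_k (aX+b)^k (cX+d)^(n-k)` of `f`, viewed as a
degree-`n` polynomial, by the matrix `M = (a b; c d)`. -/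
noncomputable def glTranslate (n : ℕ) (f : Polynomial ℤ) (M : Matrix (Fin 2) (Fin 2) ℤ) : Polynomial ℤ :=
  ∑ k ∈ Finset.range (n + 1),
    Polynomial.C (f.coeff k) * (Polynomial.C (M 0 0) * Polynomial.X + Polynomial.C (M 0 1)) ^ k *
      (Polynomial.C (M 1 0) * Polynomial.X + Polynomial.C (M 1 1)) ^ (n - k)

/-- `f` and `g`, viewed as degree-`n` polynomials, are `GL₂(ℤ)`-equivalent if
`g = ±(f∘M)` for some `M ∈ GL₂(ℤ)`. -/
def GL2Equiv (n : ℕ) (f g : Polynomial ℤ) : Prop :=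
  ∃ M : Matrix (Fin 2) (Fin 2) ℤ, IsUnit M.det ∧
    (g = glTranslate n f M ∨ g = -glTranslate n f M)

/-- The list of complex roots of `f`, counted with multiplicity (in some order). -/
noncomputable def rootList (f : Polynomial ℤ) : List ℂ :=
  ((f.map (Int.castRingHom ℂ)).roots).toList

/-- The discriminant `D(f) = f₀^(2n-2) ∏_{i<j} (αᵢ - α_j)²` of `f` (as a complex number;
it is independent of the ordering of the roots since the product is symmetric). -/
noncomputable def discC (f : Polynomial ℤ) : ℂ :=
  (f.leadingCoeff : ℂ) ^ (2 * f.natDegree - 2) *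
    ∏ p : Fin (rootList f).length × Fin (rootList f).length,
      if (p.1 : ℕ) < (p.2 : ℕ) then ((rootList f).get p.1 - (rootList f).get p.2) ^ 2 else 1

/-- `K_f := ℚ[X]/(f)`. -/
abbrev Kf (f : Polynomial ℤ) : Type := AdjoinRoot (f.map (Int.castRingHom ℚ))

/-- The residue class `α` of `X` in `K_f`. -/
noncomputable def rootOf (f : Polynomial ℤ) : Kf f := AdjoinRoot.root _

/-- `ζᵢ = f₀ αⁱ + f₁ α^(i-1) + ⋯ + f_{i-1} α`, where `f_j` is the coefficient of
`X^(n-j)` in `f`. -/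
noncomputable def zeta (f : Polynomial ℤ) (i : ℕ) : Kf f :=
  ∑ j ∈ Finset.range i, ((f.coeff (f.natDegree - j) : ℤ) : Kf f) * rootOf f ^ (i - j)

/-- The invariant module `I_f(k)`: the ℤ-span of `1, α, …, α^k, ζ_{k+1}, …, ζ_{n-1}`
inside `K_f`.  In particular `R_f = I_f(0)` and `I_f = I_f(1)`. -/
noncomputable def invModule (f : Polynomial ℤ) (k : ℕ) : Submodule ℤ (Kf f) :=
  Submodule.span ℤ
    ({x | ∃ j ≤ k, x = rootOf f ^ j} ∪
     {x | ∃ i, k + 1 ≤ i ∧ i ≤ f.natDegree - 1 ∧ x = zeta f i})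

/-- `f` and `g` are ℤ-equivalent: `g(X) = εⁿ f(εX + a)` with `ε = ±1`, `a ∈ ℤ`. -/
def ZEquiv (f g : Polynomial ℤ) : Prop :=
  ∃ ε a : ℤ, (ε = 1 ∨ ε = -1) ∧
    g = Polynomial.C (ε ^ f.natDegree) * f.comp (Polynomial.C ε * Polynomial.X + Polynomial.C a)

/-- The `(n-2)`-th partial sum `a⁽ⁿ⁾(X) = ∑_{i=0}^{n-2} Cᵢ Xⁱ` of the Catalan
generating function. -/
noncomputable def aPoly (n : ℕ) : Polynomial ℤ :=
  ∑ i ∈ Finset.range (n - 1), Polynomial.C ((catalan i : ℤ)) * Polynomial.X ^ i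

/-- The generic polynomial `X₀ T^(n-1) + X₁ T^(n-2) + ⋯ + X_{n-1}` of formal degree `n - 1`. -/
noncomputable def genericPoly (n : ℕ) (R : Type*) [CommRing R] :
    Polynomial (MvPolynomial (Fin n) R) :=
  ∑ j : Fin n, Polynomial.C (MvPolynomial.X j) * Polynomial.X ^ (n - 1 - (j : ℕ))

theorem natDegree_genericPoly_le (n : ℕ) (R : Type*) [CommRing R] :
    (genericPoly n R).natDegree ≤ n - 1 :=
  Polynomial.natDegree_sum_le_of_forall_le _ _ fun _ _ =>
    (Polynomial.natDegree_C_mul_X_pow_le _ _).trans (Nat.sub_le _ _)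

theorem map_genericPoly {R S : Type*} [CommRing R] [CommRing S] (n : ℕ) (φ : R →+* S) :
    (genericPoly n R).map (MvPolynomial.map φ) = genericPoly n S := by
  simp [genericPoly, Polynomial.map_sum]

theorem map_eval₂Hom_genericPoly {R S : Type*} [CommRing R] [CommRing S] (n : ℕ) (hn : 1 ≤ n)
    (φ : R →+* S) (g : Polynomial S) (hg : g.natDegree ≤ n - 1) :
    (genericPoly n R).map
      (MvPolynomial.eval₂Hom φ fun j : Fin n => g.coeff (n - 1 - (j : ℕ))) = g := by
  conv_rhs => rw [g.as_sum_range_C_mul_X_pow' (n := n) (by lia), ← Finset.sum_range_reflect,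
    Finset.sum_range]
  simp [genericPoly, Polynomial.map_sum]

/-- The resultant of `f`, in formal degree `n`, with the generic polynomial of formal
degree `n - 1`. -/
noncomputable def genericResultant (n : ℕ) {R : Type*} [CommRing R] (f : Polynomial R) :
    MvPolynomial (Fin n) R :=
  Polynomial.resultant (f.map MvPolynomial.C) (genericPoly n R) n (n - 1)

theorem map_genericResultant {R S : Type*} [CommRing R] [CommRing S] (n : ℕ) (φ : R →+* S)
    (f : Polynomial R) :
    MvPolynomial.map φ (genericResultant n f) = genericResultant n (f.map φ) := by
  rw [genericResultant, ← Polynomial.resultant_map_map, map_genericPoly, genericResultant,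
    Polynomial.map_map, Polynomial.map_map]
  congr 2
  ext a : 1
  simp

theorem genericResultant_C_mul {R : Type*} [CommRing R] (n : ℕ) (a : R) (f : Polynomial R) :
    genericResultant n (Polynomial.C a * f) =
      MvPolynomial.C (a ^ (n - 1)) * genericResultant n f := by
  rw [genericResultant, Polynomial.map_mul, Polynomial.map_C, Polynomial.resultant_C_mul_left,
    map_pow, genericResultant]

theorem eval₂Hom_genericResultant {R S : Type*} [CommRing R] [CommRing S] (n : ℕ) (hn : 1 ≤ n)
    (φ : R →+* S) (f : Polynomial R) (hf : f.natDegree ≤ n) (β : S) :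
    MvPolynomial.eval₂Hom φ
        (fun j : Fin n => ((Polynomial.X - Polynomial.C β) ^ (n - 1)).coeff (n - 1 - (j : ℕ)))
        (genericResultant n f) =
      (-1) ^ (n * (n - 1)) * (f.map φ).eval β ^ (n - 1) := by
  have hdeg : ((Polynomial.X - Polynomial.C β) ^ (n - 1)).natDegree ≤ n - 1 := by
    simpa using Polynomial.natDegree_pow_le_of_le (n - 1) (Polynomial.natDegree_X_sub_C_le β)
  rw [genericResultant, ← Polynomial.resultant_map_map, map_eval₂Hom_genericPoly n hn φ _ hdeg,
    Polynomial.map_map]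
  have hcomp : (MvPolynomial.eval₂Hom φ fun j : Fin n =>
      ((Polynomial.X - Polynomial.C β) ^ (n - 1)).coeff (n - 1 - (j : ℕ))).comp
        MvPolynomial.C = φ := by
    ext a
    simp
  rw [hcomp, Polynomial.resultant_X_sub_C_pow_right _ _ _ _
    (Polynomial.natDegree_map_le.trans hf)]

theorem hermiteForm_eq_genericResultant (n : ℕ) (f : Polynomial ℤ) (hfn : f.natDegree = n) :
    hermiteForm n f = genericResultant n (f.map (Int.castRingHom ℂ)) := by
  set g := f.map (Int.castRingHom ℂ) with hg
  have hsplit : g.Splits := IsAlgClosed.splits g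
  have hgn : (g.map (MvPolynomial.C (σ := Fin n))).natDegree = n := by
    rw [Polynomial.natDegree_map_eq_of_injective (MvPolynomial.C_injective _ _), hg,
      Polynomial.natDegree_map_eq_of_injective (RingHom.injective_int _), hfn]
  have hres := Polynomial.resultant_eq_prod_eval (g.map (MvPolynomial.C (σ := Fin n)))
    (genericPoly n ℂ) (n - 1) (natDegree_genericPoly_le n ℂ) (hsplit.map _)
  rw [hgn] at hres
  rw [genericResultant, hres, hsplit.roots_map_of_injective (MvPolynomial.C_injective _ _),
    Polynomial.leadingCoeff_map_of_injective (MvPolynomial.C_injective _ _), hg,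
    Polynomial.leadingCoeff_map_of_injective (RingHom.injective_int _), ← hg, hermiteForm,
    Multiset.map_map]
  simp [g, genericPoly, Polynomial.eval_finsetSum, mul_comm (MvPolynomial.X _),
    -Polynomial.X_pow_mul_C]

theorem Polynomial.IsPrimitive.map_ne_zero_of_charP {f : Polynomial ℤ} (hf : f.IsPrimitive)
    {p : ℕ} (hp : p ≠ 1) (K : Type*) [Ring K] [CharP K p] :
    f.map (Int.castRingHom K) ≠ 0 := by
  intro h
  have hdvd : Polynomial.C (p : ℤ) ∣ f := by
    rw [Polynomial.C_dvd_iff_dvd_coeff]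
    intro i
    rw [← CharP.intCast_eq_zero_iff K p]
    simpa using congrArg (fun q => q.coeff i) h
  exact hp (by simpa [Int.isUnit_iff_natAbs_eq] using hf _ hdvd)

theorem gcd_coeff_genericResultant_of_isPrimitive (n : ℕ) (hn : 1 ≤ n) (f : Polynomial ℤ)
    (hf : f.IsPrimitive) (hfn : f.natDegree ≤ n) :
    Finset.gcd (genericResultant n f).support (genericResultant n f).coeff = 1 := by
  rw [← Finset.normalize_gcd, normalize_eq_one, Int.isUnit_iff_natAbs_eq]
  by_contra h
  obtain ⟨p, hp, hpd⟩ := Nat.exists_prime_and_dvd h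
  have := Fact.mk hp
  rw [← Int.natCast_dvd, Finset.dvd_gcd_iff] at hpd
  let K := AlgebraicClosure (ZMod p)
  have : CharP K p := charP_of_injective_algebraMap (algebraMap (ZMod p) K).injective p
  obtain ⟨β, hβ⟩ : ∃ β : K, (f.map (Int.castRingHom K)).eval β ≠ 0 := by
    by_contra! hz
    exact hf.map_ne_zero_of_charP hp.ne_one K (Polynomial.funext (by simpa using hz))
  have heval := eval₂Hom_genericResultant n hn (Int.castRingHom K) f hfn β
  have hzero : (-1 : K) ^ (n * (n - 1)) *
      (f.map (Int.castRingHom K)).eval β ^ (n - 1) = 0 := by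
    rw [← heval, MvPolynomial.coe_eval₂Hom, MvPolynomial.eval₂_eq]
    refine Finset.sum_eq_zero fun d hd => ?_
    rw [eq_intCast, (CharP.intCast_eq_zero_iff K p _).2 (hpd d hd), zero_mul]
  exact mul_ne_zero (pow_ne_zero _ (neg_ne_zero.2 one_ne_zero)) (pow_ne_zero _ hβ) hzero

theorem gcd_coeff_genericResultant (n : ℕ) (hn : 1 ≤ n) (f : Polynomial ℤ)
    (hf0 : f ≠ 0) (hfn : f.natDegree ≤ n) :
    Finset.gcd (genericResultant n f).support (genericResultant n f).coeff =
      f.content ^ (n - 1) := by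
  have hc : f.content ^ (n - 1) ≠ 0 := pow_ne_zero _ (mt Polynomial.content_eq_zero_iff.1 hf0)
  have hmul : genericResultant n f =
      MvPolynomial.C (f.content ^ (n - 1)) * genericResultant n f.primPart := by
    rw [← genericResultant_C_mul, ← f.eq_C_content_mul_primPart]
  have hsupp : (genericResultant n f).support = (genericResultant n f.primPart).support := by
    ext d
    simp only [MvPolynomial.mem_support_iff]
    rw [hmul, MvPolynomial.coeff_C_mul]
    exact mul_ne_zero_iff_left hc
  have hcoeff : (genericResultant n f).coeff =
      fun d => f.content ^ (n - 1) * (genericResultant n f.primPart).coeff d := by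
    funext d
    rw [hmul, MvPolynomial.coeff_C_mul]
  rw [hsupp, hcoeff, Finset.gcd_mul_left,
    gcd_coeff_genericResultant_of_isPrimitive n hn _ f.isPrimitive_primPart
      (f.natDegree_primPart.trans_le hfn), mul_one,
    Int.normalize_of_nonneg (pow_nonneg (Int.nonneg_of_normalize_eq_self f.normalize_content) _)]

/-- the Hermite form of `f` has integer coefficients, i.e. it is the image
of a unique integral polynomial `F`, and the content of `F` is `c^(n-1)` where `c` is
the content of `f`. -/
theorem hermiteForm_integral_content (n : ℕ) (hn : 1 ≤ n) (f : Polynomial ℤ)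
    (hf0 : f ≠ 0) (hfn : f.natDegree = n) :
    ∃ F : MvPolynomial (Fin n) ℤ,
      MvPolynomial.map (Int.castRingHom ℂ) F = hermiteForm n f ∧
      Finset.gcd F.support F.coeff = f.content ^ (n - 1) ∧
      ∀ F' : MvPolynomial (Fin n) ℤ,
        MvPolynomial.map (Int.castRingHom ℂ) F' = hermiteForm n f → F' = F := by
  have hmap : MvPolynomial.map (Int.castRingHom ℂ) (genericResultant n f) = hermiteForm n f := by
    rw [map_genericResultant, hermiteForm_eq_genericResultant n f hfn]
  exact ⟨genericResultant n f, hmap, gcd_coeff_genericResultant n hn f hf0 hfn.le,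
    fun F' hF' => MvPolynomial.map_injective _ (RingHom.injective_int _) (hF'.trans hmap.symm)⟩
end

section
/- Let f, g ∈ ℤ[X] be polynomials of degree n ≥ 1 that are GL₂(ℤ)-equivalent. Then f and g are Hermite equivalent. -/
open Polynomial

namespace Polynomial

section CommRing

variable {R A : Type*} [CommRing R] [CommRing A] [Algebra R A]

lemma aeval_homogenize_eq_sum_range (p : R[X]) (n : ℕ) (x y : A) :
    MvPolynomial.aeval ![x, y] (p.homogenize n) =
      ∑ k ∈ Finset.range (n + 1), algebraMap R A (p.coeff k) * x ^ k * y ^ (n - k) := by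
  simp only [homogenize, map_sum, MvPolynomial.aeval_monomial]
  rw [Finset.Nat.sum_antidiagonal_eq_sum_range_succ_mk]
  refine Finset.sum_congr rfl fun k _ => ?_
  rw [Finsupp.prod_fintype _ _ (by simp)]
  simp [Fin.prod_univ_two, mul_assoc]

lemma aeval_homogenize_mul (p q : R[X]) {m n : ℕ} (hp : p.natDegree ≤ m) (hq : q.natDegree ≤ n)
    (x y : A) :
    MvPolynomial.aeval ![x, y] ((p * q).homogenize (m + n)) =
      MvPolynomial.aeval ![x, y] (p.homogenize m) *
        MvPolynomial.aeval ![x, y] (q.homogenize n) := by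
  rw [homogenize_mul _ _ hp hq, map_mul]

lemma aeval_homogenize_linear (a b : R) (x y : A) :
    MvPolynomial.aeval ![x, y] ((C a * X + C b).homogenize 1) =
      algebraMap R A a * x + algebraMap R A b * y := by
  simp [MvPolynomial.algHom_C]

lemma aeval_homogenize_linear_pow (a b : R) (n : ℕ) (x y : A) :
    MvPolynomial.aeval ![x, y] (((C a * X + C b) ^ n).homogenize n) =
      (algebraMap R A a * x + algebraMap R A b * y) ^ n := by
  induction n with
  | zero => simp
  | succ n ih =>
    rw [pow_succ, aeval_homogenize_mul _ _ (by compute_degree) (by compute_degree), ih,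
      aeval_homogenize_linear, pow_succ]

lemma homogenize_multiset_prod_X_sub_C (s : Multiset R) :
    (s.map fun α => X - C α).prod.homogenize s.card =
      (s.map fun α => MvPolynomial.X 0 - MvPolynomial.C α * MvPolynomial.X 1).prod := by
  nontriviality R
  induction s using Multiset.induction_on with
  | empty => simp
  | cons α s ih =>
    simp only [Multiset.map_cons, Multiset.prod_cons, Multiset.card_cons]
    have h : (X - C α : R[X]).homogenize 1 =
        MvPolynomial.X 0 - MvPolynomial.C α * MvPolynomial.X 1 := by
      rw [sub_eq_add_neg, ← C_neg]
      simp [sub_eq_add_neg]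
    rw [add_comm, homogenize_mul _ _ (by compute_degree)
      (natDegree_multiset_prod_X_sub_C_eq_card s).le, ih, h]

end CommRing

end Polynomial

/-- The matrix of the `(n-1)`-st symmetric power of `M`: its `k`-th column holds the coefficients
of `(aX+b)^(n-1-k) (cX+d)^k`, highest degree first. -/
noncomputable def symPowerMatrix (n : ℕ) (M : Matrix (Fin 2) (Fin 2) ℤ) :
    Matrix (Fin n) (Fin n) ℤ :=
  .of fun j k => ((C (M 0 0) * X + C (M 0 1)) ^ (n - 1 - (k : ℕ)) *
    (C (M 1 0) * X + C (M 1 1)) ^ (k : ℕ)).coeff (n - 1 - (j : ℕ))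

lemma sum_symPowerMatrix {A : Type*} [CommRing A] (n : ℕ) (M : Matrix (Fin 2) (Fin 2) ℤ)
    (x y : A) (k : Fin n) :
    ∑ j : Fin n, x ^ (n - 1 - (j : ℕ)) * y ^ (j : ℕ) * (symPowerMatrix n M j k : A) =
      (M 0 0 * x + M 0 1 * y) ^ (n - 1 - (k : ℕ)) * (M 1 0 * x + M 1 1 * y) ^ (k : ℕ) := by
  have hk : n - 1 - (k : ℕ) + k = n - 1 := by omega
  have hn : n - 1 + 1 = n := by omega
  have h := aeval_homogenize_mul ((C (M 0 0) * X + C (M 0 1)) ^ (n - 1 - (k : ℕ)))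
    ((C (M 1 0) * X + C (M 1 1)) ^ (k : ℕ)) (m := n - 1 - (k : ℕ)) (n := k)
    (natDegree_pow_le_of_le _ (natDegree_linear_le) |>.trans (by simp))
    (natDegree_pow_le_of_le _ (natDegree_linear_le) |>.trans (by simp)) x y
  rw [aeval_homogenize_linear_pow, aeval_homogenize_linear_pow, hk,
    aeval_homogenize_eq_sum_range, hn, ← Finset.sum_range_reflect, Finset.sum_range] at h
  simp only [eq_intCast (algebraMap ℤ A)] at h
  rw [← h]
  refine Finset.sum_congr rfl fun j _ => ?_
  rw [show n - 1 - (n - 1 - (j : ℕ)) = j by omega, symPowerMatrix, Matrix.of_apply]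
  ring

lemma symPowerMatrix_mul_adjugate (n : ℕ) (M : Matrix (Fin 2) (Fin 2) ℤ) :
    symPowerMatrix n M * symPowerMatrix n M.adjugate = M.det ^ (n - 1) • 1 := by
  have key (l : Fin n) : ∑ j : Fin n, X ^ (n - 1 - (j : ℕ)) *
      (((symPowerMatrix n M * symPowerMatrix n M.adjugate) j l : ℤ) : ℤ[X]) =
        ((M.det ^ (n - 1) : ℤ) : ℤ[X]) * X ^ (n - 1 - (l : ℕ)) := by
    have hl : n - 1 = n - 1 - (l : ℕ) + l := by omega
    have h₁ := sum_symPowerMatrix n M (X : ℤ[X]) 1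
    have h₂ := sum_symPowerMatrix n M.adjugate
      (M 0 0 * (X : ℤ[X]) + M 0 1 * 1) (M 1 0 * (X : ℤ[X]) + M 1 1 * 1) l
    simp only [← h₁, Finset.sum_mul] at h₂
    rw [Finset.sum_comm] at h₂
    simp only [Matrix.mul_apply, Int.cast_sum, Int.cast_mul, Finset.mul_sum]
    simp only [one_pow, mul_one, mul_assoc] at h₂
    rw [h₂, Matrix.adjugate_fin_two, Matrix.det_fin_two]
    simp only [Matrix.of_apply, Matrix.cons_val_zero, Matrix.cons_val_one, Matrix.cons_val',
      Matrix.cons_val_fin_one, Int.cast_neg, Int.cast_pow, Int.cast_sub, Int.cast_mul]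
    rw [show (M 1 1 : ℤ[X]) * (M 0 0 * (X : ℤ[X]) + M 0 1) + -M 0 1 * (M 1 0 * (X : ℤ[X]) + M 1 1) =
        (M 0 0 * M 1 1 - M 0 1 * M 1 0) * (X : ℤ[X]) by ring,
      show -(M 1 0 : ℤ[X]) * (M 0 0 * (X : ℤ[X]) + M 0 1) + M 0 0 * (M 1 0 * (X : ℤ[X]) + M 1 1) =
        M 0 0 * M 1 1 - M 0 1 * M 1 0 by ring, mul_pow]
    conv_rhs => rw [hl, pow_add]
    simp only [Nat.add_sub_cancel]
    ring
  ext i l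
  have h := congrArg (fun p => p.coeff (n - 1 - (i : ℕ))) (key l)
  simp only [finsetSum_coeff, ← eq_intCast (C : ℤ →+* ℤ[X]), coeff_mul_C, coeff_C_mul,
    coeff_X_pow] at h
  have hinj (j : Fin n) : n - 1 - (i : ℕ) = n - 1 - (j : ℕ) ↔ i = j := by
    rw [Fin.ext_iff]; omega
  simp only [hinj] at h
  simpa [Matrix.one_apply] using h

lemma isUnit_det_symPowerMatrix (n : ℕ) {M : Matrix (Fin 2) (Fin 2) ℤ} (hM : IsUnit M.det) :
    IsUnit (symPowerMatrix n M).det := by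
  have h := congrArg Matrix.det (symPowerMatrix_mul_adjugate n M)
  rw [Matrix.det_mul, Matrix.det_smul, Matrix.det_one, mul_one] at h
  exact isUnit_of_mul_isUnit_left (h ▸ (hM.pow _).pow _)

lemma glTranslate_eq_aeval_homogenize (n : ℕ) (f : ℤ[X]) (M : Matrix (Fin 2) (Fin 2) ℤ) :
    glTranslate n f M = MvPolynomial.aeval
      ![C (M 0 0) * X + C (M 0 1), C (M 1 0) * X + C (M 1 1)] (f.homogenize n) := by
  rw [aeval_homogenize_eq_sum_range]
  rfl

lemma card_roots_map_complex (f : ℤ[X]) :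
    (f.map (Int.castRingHom ℂ)).roots.card = f.natDegree := by
  rw [← (IsAlgClosed.splits _).natDegree_eq_card_roots]
  exact natDegree_map_eq_of_injective Int.cast_injective f

lemma map_glTranslate (f : ℤ[X]) (M : Matrix (Fin 2) (Fin 2) ℤ) :
    (glTranslate f.natDegree f M).map (Int.castRingHom ℂ) =
      C (f.leadingCoeff : ℂ) * ((f.map (Int.castRingHom ℂ)).roots.map fun α : ℂ =>
        C (M 0 0 - M 1 0 * α : ℂ) * X - C (M 1 1 * α - M 0 1 : ℂ)).prod := by
  have hmap : (glTranslate f.natDegree f M).map (Int.castRingHom ℂ) = MvPolynomial.aeval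
      ![C (M 0 0 : ℂ) * X + C (M 0 1 : ℂ), C (M 1 0 : ℂ) * X + C (M 1 1 : ℂ)]
        ((f.map (Int.castRingHom ℂ)).homogenize f.natDegree) := by
    rw [aeval_homogenize_eq_sum_range, glTranslate]
    simp [Polynomial.map_sum]
  have hf : f.map (Int.castRingHom ℂ) = C (f.leadingCoeff : ℂ) *
      ((f.map (Int.castRingHom ℂ)).roots.map fun α => X - C α).prod := by
    have h := (IsAlgClosed.splits (f.map (Int.castRingHom ℂ))).eq_prod_roots
    rwa [leadingCoeff_map_of_injective Int.cast_injective] at h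
  rw [hmap]
  conv_lhs => rw [hf, ← card_roots_map_complex, homogenize_C_mul,
    homogenize_multiset_prod_X_sub_C, map_mul, map_multiset_prod, Multiset.map_map]
  congr 1
  · simp
  · congr 1
    refine Multiset.map_congr rfl fun α _ => ?_
    simp [MvPolynomial.algHom_C]
    ring

section LinearFactors

variable {K : Type*} [Field K]

lemma coeff_multiset_prod_linear (s : Multiset K) (u v : K → K) :
    (s.map fun α => C (u α) * X - C (v α)).prod.coeff s.card = (s.map u).prod := by
  have h := coeff_multiset_prod_of_natDegree_le (s.map fun α => C (u α) * X - C (v α)) 1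
    (by
      intro p hp
      obtain ⟨α, -, rfl⟩ := Multiset.mem_map.mp hp
      compute_degree)
  simpa [Multiset.map_map, Function.comp_def, coeff_C] using h

lemma multiset_prod_linear_eq (s : Multiset K) (u v : K → K) (hu : ∀ α ∈ s, u α ≠ 0) :
    (s.map fun α => C (u α) * X - C (v α)).prod =
      C (s.map u).prod * ((s.map fun α => v α / u α).map fun β => X - C β).prod := by
  rw [map_multiset_prod, Multiset.map_map, Multiset.map_map, ← Multiset.prod_map_mul]
  congr 1
  refine Multiset.map_congr rfl fun α hα => ?_
  simp only [Function.comp_apply, mul_sub, ← C_mul, mul_div_cancel₀ _ (hu α hα)]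

end LinearFactors

lemma bind₁_linear_form (n : ℕ) (M : Matrix (Fin 2) (Fin 2) ℤ) (α : ℂ)
    (hu : (M 0 0 - M 1 0 * α : ℂ) ≠ 0) :
    MvPolynomial.C ((M 0 0 - M 1 0 * α : ℂ) ^ (n - 1)) * MvPolynomial.bind₁
        (fun i : Fin n => ∑ j : Fin n,
          MvPolynomial.C ((symPowerMatrix n M i j : ℂ)) * MvPolynomial.X j)
        (∑ j : Fin n, MvPolynomial.C (((M 1 1 * α - M 0 1) / (M 0 0 - M 1 0 * α) : ℂ) ^
          (n - 1 - (j : ℕ))) * MvPolynomial.X j) =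
      MvPolynomial.C ((M.det : ℂ) ^ (n - 1)) *
        ∑ j : Fin n, MvPolynomial.C (α ^ (n - 1 - (j : ℕ))) * MvPolynomial.X j := by
  simp only [map_sum, map_mul, MvPolynomial.bind₁_X_right, MvPolynomial.bind₁_C_right]
  simp only [Finset.mul_sum]
  rw [Finset.sum_comm]
  refine Finset.sum_congr rfl fun k _ => ?_
  have hk : n - 1 = n - 1 - (k : ℕ) + k := by omega
  have h := sum_symPowerMatrix n M (M 1 1 * α - M 0 1 : ℂ) (M 0 0 - M 1 0 * α) k
  rw [show (M 0 0 * (M 1 1 * α - M 0 1) + M 0 1 * (M 0 0 - M 1 0 * α) : ℂ) = M.det * α by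
      rw [Matrix.det_fin_two]; push_cast; ring,
    show (M 1 0 * (M 1 1 * α - M 0 1) + M 1 1 * (M 0 0 - M 1 0 * α) : ℂ) = M.det by
      rw [Matrix.det_fin_two]; push_cast; ring, mul_pow, mul_right_comm, ← pow_add, ← hk] at h
  simp only [← mul_assoc, ← Finset.sum_mul, ← MvPolynomial.C_mul, ← map_sum]
  rw [← h]
  congr 2
  refine Finset.sum_congr rfl fun j _ => ?_
  have hj : n - 1 = n - 1 - (j : ℕ) + j := by omega
  congr 1
  conv_lhs => rw [hj, pow_add]
  simp only [Nat.add_sub_cancel]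
  rw [div_pow]
  field_simp

/-- `GL₂(ℤ)`-equivalent polynomials of degree `n ≥ 1` are Hermite
equivalent. -/
theorem hermiteEquiv_of_gl2Equiv (n : ℕ) (hn : 1 ≤ n) (f g : Polynomial ℤ)
    (hfn : f.natDegree = n) (hgn : g.natDegree = n)
    (h : GL2Equiv n f g) : HermiteEquiv n f g := by
  obtain ⟨M, hM, hg⟩ := h
  obtain ⟨δ, hδ, hg⟩ : ∃ δ : ℤ, (δ = 1 ∨ δ = -1) ∧ g = C δ * glTranslate n f M := by
    rcases hg with rfl | rfl
    · exact ⟨1, Or.inl rfl, by simp⟩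
    · exact ⟨-1, Or.inr rfl, by simp⟩
  set s := (f.map (Int.castRingHom ℂ)).roots with hs
  have hcard : s.card = n := by rw [hs, card_roots_map_complex, hfn]
  set u : ℂ → ℂ := fun α => M 0 0 - M 1 0 * α
  set v : ℂ → ℂ := fun α => M 1 1 * α - M 0 1
  have hgmap : g.map (Int.castRingHom ℂ) = C (δ * f.leadingCoeff : ℂ) *
      (s.map fun α => C (u α) * X - C (v α)).prod := by
    rw [hg, Polynomial.map_mul, ← hfn, map_glTranslate, Polynomial.map_C, C_mul, mul_assoc]
    rfl
  have hlead : (g.leadingCoeff : ℂ) = δ * f.leadingCoeff * (s.map u).prod := by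
    have h := congrArg (fun p => p.coeff s.card) hgmap
    simp only [coeff_C_mul, coeff_multiset_prod_linear, coeff_map] at h
    rw [← h, leadingCoeff, hgn, hcard]
    rfl
  have hg0 : (g.leadingCoeff : ℂ) ≠ 0 := by
    have : g ≠ 0 := by rintro rfl; simp at hgn; omega
    exact_mod_cast leadingCoeff_ne_zero.mpr this
  have hu : ∀ α ∈ s, u α ≠ 0 := by
    intro α hα h0
    apply hg0
    rw [hlead, Multiset.prod_eq_zero (Multiset.mem_map.mpr ⟨α, hα, h0⟩), mul_zero]
  have hroots : (g.map (Int.castRingHom ℂ)).roots = s.map fun α => v α / u α := by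
    rw [hgmap, multiset_prod_linear_eq s u v hu, ← mul_assoc, ← C_mul, ← hlead,
      roots_C_mul _ hg0, roots_multiset_prod_X_sub_C]
  have hdet : (M.det : ℂ) ^ ((n - 1) * n) = 1 := by
    have heven : Even ((n - 1) * n) := by
      obtain ⟨m, rfl⟩ := Nat.exists_eq_add_of_le' hn
      simpa using Nat.even_mul_succ_self m
    rcases Int.isUnit_iff.mp hM with h | h <;> simp [h, heven.neg_one_pow]
  refine ⟨symPowerMatrix n M, δ ^ (n - 1), isUnit_det_symPowerMatrix n hM, ?_, ?_⟩
  · rcases hδ with rfl | rfl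
    · simp
    · exact neg_one_pow_eq_or ℤ (n - 1)
  · rw [hermiteForm, hermiteForm, hroots, hlead, ← hs, map_mul, map_multiset_prod,
      MvPolynomial.bind₁_C_right, Multiset.map_map, Multiset.map_map, mul_pow, mul_pow,
      ← Multiset.prod_map_pow, MvPolynomial.C_mul, map_multiset_prod, Multiset.map_map,
      mul_assoc, ← Multiset.prod_map_mul]
    simp only [Function.comp_apply]
    rw [Multiset.map_congr rfl fun α hα => bind₁_linear_form n M α (hu α hα),
      Multiset.prod_map_mul, Multiset.map_const', Multiset.prod_replicate, hcard,
      ← MvPolynomial.C_pow, ← pow_mul, hdet]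
    simp [mul_assoc]
end

section
/- Let f, g ∈ ℤ[X] be polynomials of degree n ≥ 1 that are Hermite equivalent. Then the discriminants of f and g are equal: D(f) = D(g). -/
open Polynomial

/-- The linear form `∑ⱼ aⱼ Xⱼ` with coefficient vector `a`. -/
noncomputable def linearForm {ι K : Type*} [Fintype ι] [Field K] (a : ι → K) : MvPolynomial ι K :=
  ∑ j, MvPolynomial.C (a j) * MvPolynomial.X j

section LinearForm

variable {ι K : Type*} [Fintype ι] [Field K]

theorem linearForm_eq_sumSMulX (a : ι → K) :
    linearForm a = MvPolynomial.sumSMulX (Finsupp.equivFunOnFinite.symm a) := by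
  simp [linearForm, MvPolynomial.sumSMulX, Finsupp.linearCombination_apply, Finsupp.sum_fintype,
    MvPolynomial.smul_eq_C_mul]

theorem linearForm_injective : Function.Injective (linearForm : (ι → K) → MvPolynomial ι K) := by
  intro a b h
  ext i
  simpa [linearForm_eq_sumSMulX, MvPolynomial.coeff_sumSMulX] using
    congrArg (MvPolynomial.coeff (Finsupp.single i 1)) h

theorem irreducible_linearForm {a : ι → K} (ha : a ≠ 0) : Irreducible (linearForm a) := by
  obtain ⟨i, hi⟩ := Function.ne_iff.1 ha
  rw [linearForm_eq_sumSMulX]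
  refine MvPolynomial.irreducible_sumSMulX _ ⟨i, by simpa using hi⟩ fun r hr => ?_
  exact isUnit_of_dvd_unit (hr i) (isUnit_iff_ne_zero.2 (by simpa using hi))

theorem C_mul_linearForm (c : K) (a : ι → K) :
    MvPolynomial.C c * linearForm a = linearForm (c • a) := by
  simp [linearForm, Finset.mul_sum, mul_assoc]

theorem bind₁_linearForm (U : Matrix ι ι K) (b : ι → K) :
    MvPolynomial.bind₁ (fun i => linearForm (U i)) (linearForm b) =
      linearForm (Matrix.vecMul b U) := by
  simp only [linearForm, map_sum, map_mul, MvPolynomial.bind₁_C_right, MvPolynomial.bind₁_X_right,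
    Matrix.vecMul, dotProduct, Finset.mul_sum, Finset.sum_mul]
  rw [Finset.sum_comm]
  simp only [mul_assoc]

theorem exists_smul_eq_of_associated_linearForm {a b : ι → K}
    (h : Associated (linearForm a) (linearForm b)) : ∃ c : K, b = c • a := by
  obtain ⟨u, hu⟩ := h
  obtain ⟨c, -, hc⟩ := MvPolynomial.isUnit_iff_eq_C_of_isReduced.1 u.isUnit
  refine ⟨c, linearForm_injective ?_⟩
  rw [← hu, hc, ← C_mul_linearForm, mul_comm]

end LinearForm

theorem Multiset.exists_perm_of_map_univ_eq {ι α : Type*} [Fintype ι] {u v : ι → α}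
    (h : Finset.univ.val.map u = Finset.univ.val.map v) :
    ∃ σ : Equiv.Perm ι, ∀ i, v (σ i) = u i := by
  classical
  have e (c : α) : {i // u i = c} ≃ {i // v i = c} := by
    refine Fintype.equivOfCardEq ?_
    have hc := congrArg (Multiset.count c) h
    simp only [Multiset.count_map, eq_comm (a := c)] at hc
    rw [Fintype.card_subtype, Fintype.card_subtype]
    exact hc
  exact ⟨Equiv.ofFiberEquiv e, Equiv.ofFiberEquiv_map e⟩

/-- A factorization into linear forms determines the forms up to order and scaling, hence
determines the square of the normalized determinant of their coefficients. -/
theorem sq_mul_det_eq_of_prod_linearForm_eq {ι K : Type*} [Fintype ι] [DecidableEq ι] [Field K]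
    {A B : Matrix ι ι K} {a b : K} (ha : a ≠ 0) (hb : b ≠ 0)
    (hA : ∀ i, A i ≠ 0) (hB : ∀ i, B i ≠ 0)
    (h : MvPolynomial.C b * ∏ i, linearForm (B i) = MvPolynomial.C a * ∏ i, linearForm (A i)) :
    (b * B.det) ^ 2 = (a * A.det) ^ 2 := by
  have hu {c : K} (hc : c ≠ 0) : IsUnit (MvPolynomial.C c : MvPolynomial ι K) :=
    (isUnit_iff_ne_zero.2 hc).map MvPolynomial.C
  have hassoc : Associated (∏ i, linearForm (A i)) (∏ i, linearForm (B i)) :=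
    (associated_isUnit_mul_left_iff (hu ha)).1 <|
      (associated_isUnit_mul_right_iff (hu hb)).1 (h ▸ Associated.refl _)
  have hrel : Multiset.Rel Associated (Finset.univ.val.map fun i => linearForm (A i))
      (Finset.univ.val.map fun i => linearForm (B i)) := by
    refine UniqueFactorizationMonoid.factors_unique ?_ ?_ hassoc
    · simpa using fun i => irreducible_linearForm (hA i)
    · simpa using fun i => irreducible_linearForm (hB i)
  rw [Associates.rel_associated_iff_map_eq_map, Multiset.map_map, Multiset.map_map] at hrel
  obtain ⟨σ, hσ⟩ := Multiset.exists_perm_of_map_univ_eq hrel.symm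
  have hc (i : ι) : ∃ c : K, B i = c • A (σ i) :=
    exists_smul_eq_of_associated_linearForm (Associates.mk_eq_mk_iff_associated.1 (hσ i))
  choose c hc using hc
  have hprod : ∏ i, linearForm (B i) = MvPolynomial.C (∏ i, c i) * ∏ i, linearForm (A i) := by
    rw [← Equiv.prod_comp σ fun i => linearForm (A i), map_prod, ← Finset.prod_mul_distrib]
    simp only [hc, C_mul_linearForm]
  have hdet : B.det = (∏ i, c i) * (Equiv.Perm.sign σ * A.det) := by
    rw [← Matrix.det_permute, ← Matrix.det_mul_column]
    congr 1
    ext i j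
    simp [hc]
  have hscal : b * ∏ i, c i = a := by
    have hne : ∏ i, linearForm (A i) ≠ 0 :=
      Finset.prod_ne_zero_iff.2 fun i _ => (irreducible_linearForm (hA i)).ne_zero
    rw [hprod, ← mul_assoc, ← map_mul] at h
    exact MvPolynomial.C_injective _ _ (mul_right_cancel₀ hne h)
  have hsign : ((Equiv.Perm.sign σ : ℤ) : K) ^ 2 = 1 := by
    rw [← Int.cast_pow, ← Units.val_pow_eq_pow_val, Int.units_sq]
    simp
  rw [hdet, ← hscal]
  linear_combination (b * (∏ i, c i) * A.det) ^ 2 * hsign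

/-- The Vandermonde matrix of `v` with decreasing exponents. -/
def revVandermonde {K : Type*} [Field K] {n : ℕ} (v : Fin n → K) : Matrix (Fin n) (Fin n) K :=
  .of fun i j => v i ^ (n - 1 - (j : ℕ))

theorem revVandermonde_row_ne_zero {K : Type*} [Field K] {n : ℕ} (v : Fin n → K) (i : Fin n) :
    revVandermonde v i ≠ 0 := by
  have hn : 0 < n := i.pos
  refine fun h => one_ne_zero (α := K) ?_
  simpa [revVandermonde] using congrFun h ⟨n - 1, by omega⟩

theorem det_revVandermonde_sq {K : Type*} [Field K] {n : ℕ} (v : Fin n → K) :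
    (revVandermonde v).det ^ 2 =
      ∏ p : Fin n × Fin n, if (p.1 : ℕ) < (p.2 : ℕ) then (v p.1 - v p.2) ^ 2 else 1 := by
  have hA : revVandermonde v = (Matrix.vandermonde v).submatrix id Fin.revPerm := by
    ext i j
    simp [revVandermonde, Matrix.vandermonde, Fin.val_rev, Nat.sub_sub, add_comm]
  have hsign : ((Equiv.Perm.sign (Fin.revPerm : Equiv.Perm (Fin n)) : ℤ) : K) ^ 2 = 1 := by
    rw [← Int.cast_pow, ← Units.val_pow_eq_pow_val, Int.units_sq]
    simp
  rw [hA, Matrix.det_permute', mul_pow, hsign, one_mul, Matrix.det_vandermonde,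
    ← Finset.prod_pow, Fintype.prod_prod_type]
  refine Finset.prod_congr rfl fun i _ => ?_
  rw [← Finset.prod_pow, ← Finset.prod_filter]
  refine Finset.prod_congr (by ext j; simp) fun j _ => by ring

theorem length_rootList (f : Polynomial ℤ) : (rootList f).length = f.natDegree := by
  rw [rootList, Multiset.length_toList]
  exact IsAlgClosed.card_roots_map_eq_natDegree_of_injective f Int.cast_injective

/-- The roots of `f`, indexed by `Fin n`, compute the Hermite form and the discriminant. -/
theorem exists_roots_hermiteForm_discC {n : ℕ} {f : Polynomial ℤ} (hf : f.natDegree = n) :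
    ∃ v : Fin n → ℂ,
      hermiteForm n f = MvPolynomial.C ((f.leadingCoeff : ℂ) ^ (n - 1)) *
        ∏ i, linearForm (revVandermonde v i) ∧
      discC f = ((f.leadingCoeff : ℂ) ^ (n - 1) * (revVandermonde v).det) ^ 2 := by
  obtain rfl : (rootList f).length = n := (length_rootList f).trans hf
  refine ⟨(rootList f).get, ?_, ?_⟩
  · have hroots : (f.map (Int.castRingHom ℂ)).roots =
        Finset.univ.val.map (rootList f).get := by
      rw [Fin.univ_val_map, List.ofFn_get, rootList, Multiset.coe_toList]
    rw [hermiteForm, hroots, Multiset.map_map]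
    rfl
  · rw [mul_pow, det_revVandermonde_sq, discC, hf, ← pow_mul, Nat.sub_mul, one_mul, mul_comm 2]

/-- Hermite equivalent polynomials of degree `n ≥ 1` have equal
discriminants. -/
theorem discC_eq_of_hermiteEquiv (n : ℕ) (hn : 1 ≤ n) (f g : Polynomial ℤ)
    (hfn : f.natDegree = n) (hgn : g.natDegree = n)
    (h : HermiteEquiv n f g) : discC f = discC g := by
  obtain ⟨U, ε, hU, hε, h⟩ := h
  obtain ⟨v, hvH, hvD⟩ := exists_roots_hermiteForm_discC hfn
  obtain ⟨w, hwH, hwD⟩ := exists_roots_hermiteForm_discC hgn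
  have lc_ne {p : Polynomial ℤ} (hp : p.natDegree = n) : (p.leadingCoeff : ℂ) ^ (n - 1) ≠ 0 := by
    refine pow_ne_zero _ (Int.cast_ne_zero.2 (leadingCoeff_ne_zero.2 ?_))
    rintro rfl
    simp at hp
    omega
  have hε_sq : (ε : ℂ) ^ 2 = 1 := by rcases hε with rfl | rfl <;> simp
  have hε_ne : (ε : ℂ) ≠ 0 := by rcases hε with rfl | rfl <;> simp
  set V : Matrix (Fin n) (Fin n) ℂ := U.map (Int.castRingHom ℂ) with hV
  have hVdet : V.det = (U.det : ℂ) := by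
    simpa [hV] using ((Int.castRingHom ℂ).map_det U).symm
  have hVunit : IsUnit V := by
    rw [Matrix.isUnit_iff_isUnit_det, hVdet]
    exact hU.map (Int.castRingHom ℂ)
  have hVdet_sq : V.det ^ 2 = 1 := by
    rw [hVdet, ← Int.cast_pow, Int.isUnit_sq hU, Int.cast_one]
  have hrow (i : Fin n) : (revVandermonde w * V) i ≠ 0 := fun h0 =>
    revVandermonde_row_ne_zero w i <|
      Matrix.vecMul_injective_of_isUnit hVunit (h0.trans (Matrix.zero_vecMul V).symm)
  have key := sq_mul_det_eq_of_prod_linearForm_eq (mul_ne_zero hε_ne (lc_ne hfn)) (lc_ne hgn)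
    (revVandermonde_row_ne_zero v) hrow (by
      rw [hvH, hwH, map_mul, MvPolynomial.bind₁_C_right, map_prod, ← mul_assoc, ← map_mul] at h
      rw [← h]
      congr 1
      exact Finset.prod_congr rfl fun i _ => (bind₁_linearForm V _).symm)
  rw [hvD, hwD]
  rw [Matrix.det_mul] at key
  linear_combination -key + ((g.leadingCoeff : ℂ) ^ (n - 1) * (revVandermonde w).det) ^ 2 * hVdet_sq
    - ((f.leadingCoeff : ℂ) ^ (n - 1) * (revVandermonde v).det) ^ 2 * hε_sq
end

section
/- Let f, g ∈ ℤ[X] be polynomials of degree n ≥ 2 with nonzero discriminant. Then f and g are Hermite equivalent if and only if there exist a ℚ-algebra isomorphism φ : K_f → K_g and a unit κ ∈ K_g^× such that φ maps R_f onto R_g and φ maps I_f(n−1) onto κ·I_g(n−1), where κ·I_g(n−1) denotes the ℤ-submodule {κ·x : x ∈ I_g(n−1)} of K_g. -/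
open Polynomial

/-- The module spanned by `1, x, …, x^k, ζ_{k+1}, …, ζ_{n-1}`, where the `ζᵢ` are the partial
Horner sums of `f` evaluated at an element `x` of an arbitrary commutative ring. -/
noncomputable def invModuleAt {A : Type*} [CommRing A] (f : Polynomial ℤ) (x : A) (k : ℕ) :
    Submodule ℤ A :=
  Submodule.span ℤ
    ({y | ∃ j ≤ k, y = x ^ j} ∪
     {y | ∃ i, k + 1 ≤ i ∧ i ≤ f.natDegree - 1 ∧
      y = ∑ j ∈ Finset.range i, ((f.coeff (f.natDegree - j) : ℤ) : A) * x ^ (i - j)})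

theorem invModule_eq_invModuleAt (f : Polynomial ℤ) (k : ℕ) :
    invModule f k = invModuleAt f (rootOf f) k := rfl

theorem image_invModuleAt {A B : Type*} [CommRing A] [CommRing B] (ψ : A →+* B)
    (f : Polynomial ℤ) (x : A) (k : ℕ) :
    ψ '' (invModuleAt f x k : Set A) = (invModuleAt f (ψ x) k : Set B) := by
  have h := Submodule.map_span (ψ.toAddMonoidHom.toIntLinearMap)
    ({y | ∃ j ≤ k, y = x ^ j} ∪
     {y | ∃ i, k + 1 ≤ i ∧ i ≤ f.natDegree - 1 ∧
      y = ∑ j ∈ Finset.range i, ((f.coeff (f.natDegree - j) : ℤ) : A) * x ^ (i - j)})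
  have h2 := congrArg (fun S : Submodule ℤ B => (S : Set B)) h
  rw [invModuleAt, invModuleAt]
  refine h2.trans ?_
  congr 2
  ext y
  simp only [Set.image_union, Set.mem_union, Set.mem_image, Set.mem_ofPred_eq]
  constructor
  · rintro (⟨_, ⟨j, hj, rfl⟩, rfl⟩ | ⟨_, ⟨i, h1, h2, rfl⟩, rfl⟩)
    · exact Or.inl ⟨j, hj, by simp⟩
    · exact Or.inr ⟨i, h1, h2, by simp⟩
  · rintro (⟨j, hj, rfl⟩ | ⟨i, h1, h2, rfl⟩)
    · exact Or.inl ⟨_, ⟨j, hj, rfl⟩, by simp⟩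
    · exact Or.inr ⟨_, ⟨i, h1, h2, rfl⟩, by simp⟩

/-- The polynomial `f₀ Xⁱ + f₁ X^(i-1) + ⋯ + f_{i-1} X`. -/
noncomputable def zetaPoly (f : Polynomial ℤ) (i : ℕ) : Polynomial ℤ :=
  ∑ j ∈ Finset.range i, C (f.coeff (f.natDegree - j)) * X ^ (i - j)

theorem aeval_zetaPoly {A : Type*} [CommRing A] (f : Polynomial ℤ) (x : A) (i : ℕ) :
    aeval x (zetaPoly f i) =
      ∑ j ∈ Finset.range i, ((f.coeff (f.natDegree - j) : ℤ) : A) * x ^ (i - j) := by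
  simp [zetaPoly]

theorem zetaPoly_succ (f : Polynomial ℤ) (i : ℕ) :
    zetaPoly f (i + 1) = X * zetaPoly f i + C (f.coeff (f.natDegree - i)) * X := by
  rw [zetaPoly, Finset.sum_range_succ, zetaPoly, Finset.mul_sum]
  congr 1
  · refine Finset.sum_congr rfl fun j hj => ?_
    have : i + 1 - j = (i - j) + 1 := by have := Finset.mem_range.1 hj; omega
    rw [this, pow_succ]; ring
  · simp

theorem natDegree_zetaPoly_le (f : Polynomial ℤ) (i : ℕ) : (zetaPoly f i).natDegree ≤ i :=
  natDegree_sum_le_of_forall_le _ _ fun _ _ =>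
    (natDegree_C_mul_X_pow_le _ _).trans (Nat.sub_le _ _)

theorem coeff_zetaPoly_self (f : Polynomial ℤ) {i : ℕ} (hi : i ≠ 0) :
    (zetaPoly f i).coeff i = f.leadingCoeff := by
  rw [zetaPoly, finsetSum_coeff, Finset.sum_eq_single_of_mem 0 (by simpa using Nat.pos_of_ne_zero hi)]
  · simp
  · intro j hj hj0
    have := Finset.mem_range.1 hj
    rw [coeff_C_mul_X_pow, if_neg (by omega)]

theorem X_pow_mul_zetaPoly_add (f : Polynomial ℤ) {i : ℕ} (hi : i ≤ f.natDegree) :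
    X ^ (f.natDegree - i) * zetaPoly f i +
      ∑ k ∈ Finset.range (f.natDegree - i + 1), C (f.coeff k) * X ^ k = f := by
  induction i with
  | zero => simpa [zetaPoly] using f.as_sum_range_C_mul_X_pow.symm
  | succ i ih =>
    specialize ih (by omega)
    obtain ⟨m, hm⟩ : ∃ m, f.natDegree - i = m + 1 := ⟨f.natDegree - i - 1, by omega⟩
    rw [zetaPoly_succ, hm, show f.natDegree - (i + 1) = m by omega]
    rw [hm, Finset.sum_range_succ] at ih
    conv_rhs => rw [← ih]
    ring

/-- The lattice spanned by `1, x, …, x^(n-1)`, as the image of the polynomials of degree `< n`. -/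
theorem mem_invModuleAt_top {A : Type*} [CommRing A] {n : ℕ} (hn : n ≠ 0) {f : Polynomial ℤ}
    (hf : f.natDegree = n) (x y : A) :
    y ∈ invModuleAt f x (n - 1) ↔ ∃ P ∈ degreeLT ℤ n, aeval x P = y := by
  have h : invModuleAt f x (n - 1) = (degreeLT ℤ n).map (aeval x : ℤ[X] →ₐ[ℤ] A).toLinearMap := by
    rw [degreeLT_eq_span_X_pow, Submodule.map_span, invModuleAt]
    congr 1
    ext y
    simp only [Set.mem_union, Set.mem_ofPred_eq, Finset.coe_image, Set.mem_image, Finset.coe_range,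
      Set.mem_Iio, hf]
    constructor
    · rintro (⟨j, hj, rfl⟩ | ⟨i, h1, h2, -⟩)
      · exact ⟨_, ⟨j, by omega, rfl⟩, by simp⟩
      · omega
    · rintro ⟨_, ⟨j, hj, rfl⟩, rfl⟩
      exact Or.inl ⟨j, by omega, by simp⟩
  rw [h]; rfl

theorem one_mem_invModuleAt {A : Type*} [CommRing A] (f : Polynomial ℤ) (x : A) (k : ℕ) :
    (1 : A) ∈ invModuleAt f x k :=
  Submodule.subset_span (Or.inl ⟨0, Nat.zero_le _, by simp⟩)

theorem aeval_zetaPoly_mem_invModuleAt {A : Type*} [CommRing A] (f : Polynomial ℤ) (x : A)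
    {i : ℕ} (h1 : 1 ≤ i) (h2 : i ≤ f.natDegree - 1) :
    aeval x (zetaPoly f i) ∈ invModuleAt f x 0 :=
  Submodule.subset_span (Or.inr ⟨i, by omega, h2, aeval_zetaPoly f x i⟩)

theorem mem_degreeLT_of_natDegree_lt {R : Type*} [Semiring R] {n : ℕ} {P : R[X]}
    (h : P.natDegree < n) : P ∈ degreeLT R n :=
  mem_degreeLT.2 (degree_le_natDegree.trans_lt (by exact_mod_cast h))

theorem mul_zeta_mem {A : Type*} [CommRing A] {n : ℕ} (hn : n ≠ 0) {f : Polynomial ℤ}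
    (hf : f.natDegree = n) {x : A} (hx : aeval x f = 0) {i j : ℕ} (hi : i ≤ n - 1)
    (hj : j ≤ n - 1) :
    aeval x (zetaPoly f i) * x ^ j ∈ invModuleAt f x (n - 1) := by
  rw [mem_invModuleAt_top hn hf]
  by_cases h : i + j ≤ n - 1
  · refine ⟨zetaPoly f i * X ^ j, ?_, by simp⟩
    refine mem_degreeLT_of_natDegree_lt (lt_of_le_of_lt (natDegree_mul_le_of_le
      (natDegree_zetaPoly_le f i) (natDegree_X_pow_le j)) (by omega))
  · refine ⟨-(X ^ (i + j - n) * ∑ k ∈ Finset.range (n - i + 1), C (f.coeff k) * X ^ k), ?_, ?_⟩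
    · refine mem_degreeLT_of_natDegree_lt ?_
      rw [natDegree_neg]
      refine lt_of_le_of_lt (natDegree_mul_le_of_le (natDegree_X_pow_le _)
        (natDegree_sum_le_of_forall_le (n := n - i) _ _ fun k hk => ?_)) (by omega)
      exact (natDegree_C_mul_X_pow_le _ _).trans (by have := Finset.mem_range.1 hk; omega)
    · have h1 := X_pow_mul_zetaPoly_add f (i := i) (by omega)
      rw [hf] at h1
      have h2 : X ^ (i + j - n) * (X ^ (n - i) * zetaPoly f i) = zetaPoly f i * X ^ j := by
        rw [← mul_assoc, ← pow_add, mul_comm]; congr 2; omega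
      have h3 := congrArg (aeval x) h2
      have h4 := congrArg (aeval x) h1
      simp only [map_mul, map_add, map_neg, map_pow, aeval_X, hx] at h3 h4 ⊢
      rw [← h3]
      linear_combination -(x ^ (i+j-n)) * h4

theorem invModuleAt_zero_mul_mem {A : Type*} [CommRing A] {n : ℕ} (hn : n ≠ 0) {f : Polynomial ℤ}
    (hf : f.natDegree = n) {x : A} (hx : aeval x f = 0) {y m : A}
    (hy : y ∈ invModuleAt f x 0) (hm : m ∈ invModuleAt f x (n - 1)) :
    y * m ∈ invModuleAt f x (n - 1) := by
  refine Submodule.span_induction (p := fun m _ => y * m ∈ invModuleAt f x (n - 1))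
    ?_ (by simp) (fun a b _ _ ha hb => by rw [mul_add]; exact add_mem ha hb)
    (fun c a _ ha => by rw [mul_smul_comm]; exact Submodule.smul_mem _ c ha) hm
  rintro _ (⟨j, hj, rfl⟩ | ⟨i, h1, h2, -⟩)
  · refine Submodule.span_induction (p := fun y _ => y * x ^ j ∈ invModuleAt f x (n - 1))
      ?_ (by simp) (fun a b _ _ ha hb => by rw [add_mul]; exact add_mem ha hb)
      (fun c a _ ha => by rw [smul_mul_assoc]; exact Submodule.smul_mem _ c ha) hy
    rintro _ (⟨k, hk, rfl⟩ | ⟨i, h1, h2, rfl⟩)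
    · obtain rfl : k = 0 := by omega
      rw [pow_zero, one_mul]
      exact Submodule.subset_span (Or.inl ⟨j, hj, rfl⟩)
    · rw [← aeval_zetaPoly]
      exact mul_zeta_mem hn hf hx (hf ▸ h2) hj
  · omega

/-- For primitive `f`, an element multiplying `⟨1, x, …, x^(n-1)⟩` into itself lies in the
invariant order. -/
theorem mem_invModuleAt_zero_of_mul_mem {A : Type*} [CommRing A] {n : ℕ} (hn : n ≠ 0)
    {f : Polynomial ℤ} (hf : f.natDegree = n) (hprim : f.IsPrimitive) {x : A}
    (hx : aeval x f = 0) (hli : ∀ P ∈ degreeLT ℤ n, aeval x P = 0 → P = 0) {y : A}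
    (hy : ∀ m ∈ invModuleAt f x (n - 1), y * m ∈ invModuleAt f x (n - 1)) :
    y ∈ invModuleAt f x 0 := by
  have key : ∀ d, d < n → ∀ Q : ℤ[X], Q.natDegree ≤ d →
      (∀ m ∈ invModuleAt f x (n - 1), aeval x Q * m ∈ invModuleAt f x (n - 1)) →
      aeval x Q ∈ invModuleAt f x 0 := by
    intro d
    induction d with
    | zero =>
      intro _ Q hQ _
      rw [eq_C_of_natDegree_le_zero hQ, aeval_C, Algebra.algebraMap_eq_smul_one]
      exact Submodule.smul_mem _ _ (one_mem_invModuleAt f x 0)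
    | succ d ih =>
      intro hd Q hQ hmul
      -- the product with `x^(n-d-1)` forces the leading coefficient of `f` to divide that of `Q`
      obtain ⟨P, hP, hPx⟩ := (mem_invModuleAt_top hn hf x _).1 (hmul (x ^ (n - (d + 1)))
        (Submodule.subset_span (Or.inl ⟨_, by omega, rfl⟩)))
      set c := Q.coeff (d + 1) with hc
      have hdiv : C f.leadingCoeff ∣ C c * f := by
        refine ⟨Q * X ^ (n - (d + 1)) - P, ?_⟩
        rw [eq_comm, ← sub_eq_zero]
        refine hli _ ?_ ?_
        · rw [mem_degreeLT, degree_lt_iff_coeff_zero]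
          intro m hm
          have hPm : P.coeff m = 0 :=
            (degree_lt_iff_coeff_zero P n).1 (mem_degreeLT.1 hP) m hm
          rw [coeff_sub, coeff_C_mul, coeff_C_mul, coeff_sub, hPm, coeff_mul_X_pow',
            if_pos (by omega)]
          rcases hm.eq_or_lt with rfl | hlt
          · rw [show n - (n - (d + 1)) = d + 1 by omega, ← hc, leadingCoeff, hf]
            ring
          · rw [coeff_eq_zero_of_natDegree_lt (p := Q) (by omega),
              coeff_eq_zero_of_natDegree_lt (p := f) (by omega)]
            ring
        · simp [hx, hPx]
      have hdiv' : f.leadingCoeff ∣ c := by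
        have := (dvd_content_iff_C_dvd).2 hdiv
        rw [content_C_mul, hprim.content_eq_one, mul_one] at this
        exact (dvd_normalize_iff).1 this
      obtain ⟨c', hc'⟩ := hdiv'
      have hzmem := aeval_zetaPoly_mem_invModuleAt f x (i := d + 1) (by omega) (by omega)
      have hstep := ih (by omega) (Q - C c' * zetaPoly f (d + 1)) ?_ ?_
      · have : aeval x Q = aeval x (Q - C c' * zetaPoly f (d + 1)) +
            c' • aeval x (zetaPoly f (d + 1)) := by simp
        rw [this]
        exact add_mem hstep (Submodule.smul_mem _ _ hzmem)
      · rw [natDegree_le_iff_coeff_eq_zero]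
        intro N hN
        rw [coeff_sub, coeff_C_mul]
        rcases (Nat.succ_le_of_lt hN).eq_or_lt with rfl | hlt
        · rw [coeff_zetaPoly_self f (by omega), ← hc, hc', mul_comm, sub_self]
        · rw [coeff_eq_zero_of_natDegree_lt (p := Q) (by omega), coeff_eq_zero_of_natDegree_lt
            ((natDegree_zetaPoly_le f (d + 1)).trans_lt hlt), mul_zero, sub_zero]
      · intro m hm
        have : aeval x (Q - C c' * zetaPoly f (d + 1)) * m = aeval x Q * m -
            c' • (aeval x (zetaPoly f (d + 1)) * m) := by simp; ring
        rw [this]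
        exact sub_mem (hmul m hm) (Submodule.smul_mem _ _
          (invModuleAt_zero_mul_mem hn hf hx hzmem hm))
  obtain ⟨Q, hQ, hQx⟩ := (mem_invModuleAt_top hn hf x _).1
    (hy 1 (one_mem_invModuleAt f x _))
  rw [mul_one] at hQx
  rw [← hQx] at hy ⊢
  refine key (n - 1) (by omega) Q ?_ hy
  rw [natDegree_le_iff_coeff_eq_zero]
  exact fun N hN => (degree_lt_iff_coeff_zero Q n).1 (mem_degreeLT.1 hQ) N (by omega)

/-- The invariant order of `C c * f`. -/
theorem mem_invModuleAt_C_mul {A : Type*} [CommRing A] {f : Polynomial ℤ} {c : ℤ} (hc : c ≠ 0)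
    (x y : A) :
    y ∈ invModuleAt (C c * f) x 0 ↔ ∃ m : ℤ, ∃ r ∈ invModuleAt f x 0, y = (m : A) + c * r := by
  have hdeg : (C c * f).natDegree = f.natDegree := natDegree_C_mul hc
  constructor
  · intro hy
    refine Submodule.span_induction
      (p := fun y _ => ∃ m : ℤ, ∃ r ∈ invModuleAt f x 0, y = (m : A) + c * r) ?_
      ⟨0, 0, by simp, by simp⟩ ?_ ?_ hy
    · rintro _ (⟨k, hk, rfl⟩ | ⟨i, h1, h2, rfl⟩)
      · obtain rfl : k = 0 := by omega
        exact ⟨1, 0, by simp, by simp⟩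
      · refine ⟨0, _, aeval_zetaPoly_mem_invModuleAt f x (i := i) (by omega) (hdeg ▸ h2), ?_⟩
        rw [hdeg, aeval_zetaPoly]
        simp [Finset.mul_sum, mul_assoc]
    · rintro _ _ - - ⟨m, r, hr, rfl⟩ ⟨m', r', hr', rfl⟩
      exact ⟨m + m', r + r', add_mem hr hr', by push_cast; ring⟩
    · rintro a _ - ⟨m, r, hr, rfl⟩
      exact ⟨a * m, a • r, Submodule.smul_mem _ _ hr, by simp; ring⟩
  · rintro ⟨m, r, hr, rfl⟩
    have hm : (m : A) = m • (1 : A) := by simp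
    refine add_mem (hm ▸ Submodule.smul_mem _ _ (one_mem_invModuleAt _ x 0)) ?_
    refine Submodule.span_induction
      (p := fun r _ => (c : A) * r ∈ invModuleAt (C c * f) x 0) ?_ (by simp)
      (fun a b _ _ ha hb => by rw [mul_add]; exact add_mem ha hb)
      (fun c a _ ha => by rw [mul_smul_comm]; exact Submodule.smul_mem _ _ ha) hr
    rintro _ (⟨k, hk, rfl⟩ | ⟨i, h1, h2, rfl⟩)
    · obtain rfl : k = 0 := by omega
      have : (c : A) * x ^ 0 = c • (1 : A) := by simp
      rw [this]
      exact Submodule.smul_mem _ _ (one_mem_invModuleAt _ x 0)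
    · have := aeval_zetaPoly_mem_invModuleAt (C c * f) x (i := i) (by omega) (hdeg.symm ▸ h2)
      convert this using 1
      rw [aeval_zetaPoly, hdeg]
      simp [Finset.mul_sum, mul_assoc]

theorem aeval_fun_apply {R ι : Type*} [CommRing R] [Algebra R ℂ] (a : ι → ℂ) (P : R[X]) (i : ι) :
    aeval a P i = aeval (a i) P :=
  (aeval_algHom_apply (Pi.evalAlgHom R (fun _ : ι => ℂ) i) a P).symm

theorem eq_zero_of_aeval_pi_eq_zero {R : Type*} [CommRing R] [Algebra R ℂ]
    (hinj : Function.Injective (algebraMap R ℂ)) {n : ℕ} {a : Fin n → ℂ}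
    (ha : Function.Injective a) {P : R[X]} (hP : P ∈ degreeLT R n) (h : aeval a P = 0) :
    P = 0 := by
  rcases Nat.eq_zero_or_pos n with rfl | hn
  · simpa [mem_degreeLT] using hP
  have h1 : P.natDegree < n := by
    by_cases h0 : P = 0
    · simpa [h0] using hn
    · exact (natDegree_lt_iff_degree_lt h0).2 (mem_degreeLT.1 hP)
  refine (Polynomial.map_eq_zero_iff hinj).1 ?_
  refine eq_zero_of_natDegree_lt_card_of_eval_eq_zero _ ha (fun i => ?_)
    (by rw [Fintype.card_fin]; exact natDegree_map_le.trans_lt h1)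
  rw [eval_map_algebraMap, ← aeval_fun_apply, h, Pi.zero_apply]

/-- The matrix whose `i`-th row is `(aᵢ^(n-1), …, aᵢ, 1)`. -/
def powMatrix {n : ℕ} (a : Fin n → ℂ) : Matrix (Fin n) (Fin n) ℂ :=
  Matrix.of fun i j => a i ^ (n - 1 - (j : ℕ))

theorem det_powMatrix_ne_zero {n : ℕ} {a : Fin n → ℂ} (ha : Function.Injective a) :
    (powMatrix a).det ≠ 0 := by
  have h : powMatrix a = Matrix.projVandermonde 1 a := by
    ext i j
    simp only [powMatrix, Matrix.of_apply, Matrix.projVandermonde_apply, Pi.one_apply, one_pow,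
      one_mul, Fin.val_rev]
    congr 1; omega
  rw [h, Matrix.det_projVandermonde]
  refine Finset.prod_ne_zero_iff.2 fun i _ => Finset.prod_ne_zero_iff.2 fun j hj => ?_
  have hij : i ≠ j := (Finset.mem_Ioi.1 hj).ne
  simpa [sub_eq_zero] using fun e => hij (ha e)

/-- The `ℤ`-lattice spanned by the columns of a matrix. -/
def colLattice {n : ℕ} (V : Matrix (Fin n) (Fin n) ℂ) : Submodule ℤ (Fin n → ℂ) :=
  Submodule.span ℤ (Set.range fun j i => V i j)

theorem colLattice_le_iff {n : ℕ} {V W : Matrix (Fin n) (Fin n) ℂ} :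
    colLattice V ≤ colLattice W ↔
      ∃ U : Matrix (Fin n) (Fin n) ℤ, V = W * U.map (Int.cast : ℤ → ℂ) := by
  rw [colLattice, Submodule.span_le]
  constructor
  · intro h
    have h1 : ∀ j, ∃ c : Fin n → ℤ, ∑ k, c k • (fun i => W i k) = fun i => V i j := fun j =>
      (Submodule.mem_span_range_iff_exists_fun ℤ).1 (h ⟨j, rfl⟩)
    choose c hc using h1
    refine ⟨Matrix.of fun k j => c j k, ?_⟩
    ext i j
    have := congrFun (hc j) i
    simp only [Finset.sum_apply, zsmul_eq_mul] at this
    rw [← this, Matrix.mul_apply]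
    exact Finset.sum_congr rfl fun k _ => by simp [mul_comm]
  · rintro ⟨U, rfl⟩ _ ⟨j, rfl⟩
    refine (Submodule.mem_span_range_iff_exists_fun ℤ).2 ⟨fun k => U k j, ?_⟩
    ext i
    simp only [Finset.sum_apply, zsmul_eq_mul, Matrix.mul_apply, Matrix.map_apply]
    exact Finset.sum_congr rfl fun k _ => mul_comm _ _

theorem colLattice_eq_iff {n : ℕ} {V W : Matrix (Fin n) (Fin n) ℂ} (hV : V.det ≠ 0) :
    colLattice V = colLattice W ↔
      ∃ U : Matrix (Fin n) (Fin n) ℤ, IsUnit U.det ∧ V = W * U.map (Int.cast : ℤ → ℂ) := by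
  constructor
  · intro h
    obtain ⟨U, hU⟩ := colLattice_le_iff.1 h.le
    obtain ⟨U', hU'⟩ := colLattice_le_iff.1 h.ge
    refine ⟨U, ?_, hU⟩
    have h1 : V * 1 = V * (U' * U).map (Int.cast : ℤ → ℂ) := by
      rw [mul_one, show ((U' * U).map (Int.cast : ℤ → ℂ)) = _ from
        Matrix.map_mul (f := Int.castRingHom ℂ), ← mul_assoc]
      simp only [Int.coe_castRingHom]
      rw [← hU', ← hU]
    have h2 : (1 : Matrix (Fin n) (Fin n) ℂ) = (U' * U).map (Int.cast : ℤ → ℂ) :=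
      ((Matrix.isUnit_iff_isUnit_det V).2 hV.isUnit).mul_left_cancel h1
    have h3 : U' * U = 1 := by
      refine Matrix.map_injective (f := (Int.cast : ℤ → ℂ)) Int.cast_injective ?_
      show (U' * U).map _ = (1 : Matrix (Fin n) (Fin n) ℤ).map _
      rw [← h2, Matrix.map_one _ Int.cast_zero Int.cast_one]
    exact isUnit_iff_exists_inv'.2 ⟨U'.det, by rw [← Matrix.det_mul, h3, Matrix.det_one]⟩
  · rintro ⟨U, hU, h⟩
    refine le_antisymm (colLattice_le_iff.2 ⟨U, h⟩) (colLattice_le_iff.2 ⟨U⁻¹, ?_⟩)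
    rw [h, mul_assoc]
    have : U.map (Int.cast : ℤ → ℂ) * U⁻¹.map (Int.cast : ℤ → ℂ) = 1 := by
      have := Matrix.map_mul (f := Int.castRingHom ℂ) (L := U) (M := U⁻¹)
      rw [Matrix.mul_nonsing_inv U hU] at this
      simpa using this.symm
    rw [this, mul_one]

theorem invModuleAt_top_eq_colLattice {n : ℕ} {f : Polynomial ℤ} (hn : n ≠ 0)
    (hf : f.natDegree = n) (a : Fin n → ℂ) :
    invModuleAt f a (n - 1) = colLattice (powMatrix a) := by
  rw [invModuleAt, colLattice]
  congr 1
  ext y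
  simp only [Set.mem_union, Set.mem_ofPred_eq, Set.mem_range, hf]
  constructor
  · rintro (⟨j, hj, rfl⟩ | ⟨i, h1, h2, -⟩)
    · refine ⟨⟨n - 1 - j, by omega⟩, ?_⟩
      ext i
      simp [powMatrix, show n - 1 - (n - 1 - j) = j by omega]
    · omega
  · rintro ⟨j, rfl⟩
    exact Or.inl ⟨n - 1 - j, by omega, rfl⟩

theorem image_mul_colLattice {n : ℕ} (κ : Fin n → ℂ) (V : Matrix (Fin n) (Fin n) ℂ) :
    (fun y => κ * y) '' (colLattice V : Set (Fin n → ℂ)) =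
      colLattice (Matrix.diagonal κ * V) := by
  have h := Submodule.map_span (AddMonoidHom.mulLeft κ).toIntLinearMap
    (Set.range fun j i => V i j)
  refine (congrArg (fun S : Submodule ℤ (Fin n → ℂ) => (S : Set (Fin n → ℂ))) h).trans ?_
  rw [colLattice, ← Set.range_comp]
  congr 3
  ext j i
  simp

/-- The polynomials `ζ_{n-1}, …, ζ_1, 1` giving the standard basis of the invariant order. -/
noncomputable def orderPoly (f : Polynomial ℤ) (n j : ℕ) : Polynomial ℤ :=
  if j = n - 1 then 1 else zetaPoly f (n - 1 - j)

/-- The matrix expressing the standard basis of the invariant order in powers of the root. -/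
noncomputable def orderMatrix (f : Polynomial ℤ) (n : ℕ) : Matrix (Fin n) (Fin n) ℤ :=
  Matrix.of fun k j => (orderPoly f n j).coeff (n - 1 - k)

theorem natDegree_orderPoly_le (f : Polynomial ℤ) (n j : ℕ) :
    (orderPoly f n j).natDegree ≤ n - 1 - j := by
  unfold orderPoly
  split_ifs
  · simp
  · exact natDegree_zetaPoly_le _ _

theorem det_orderMatrix (f : Polynomial ℤ) {n : ℕ} (hn : n ≠ 0) :
    (orderMatrix f n).det = f.leadingCoeff ^ (n - 1) := by
  rw [Matrix.det_of_isLowerTriangular]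
  · obtain ⟨m, rfl⟩ := Nat.exists_eq_succ_of_ne_zero hn
    rw [Fin.prod_univ_castSucc]
    simp only [orderMatrix, orderPoly, Matrix.of_apply]
    have : ∀ i : Fin m, ((i : ℕ) = m) = False := fun i => by simp [i.2.ne]
    simp only [Fin.val_castSucc, Nat.succ_eq_add_one, Nat.add_sub_cancel, this, if_false,
      Fin.val_last]
    rw [Finset.prod_congr rfl fun (i : Fin m) _ =>
      coeff_zetaPoly_self f (i := m - (i : ℕ)) (by have := i.2; omega)]
    simp
  · intro k j hkj
    have hkj' : k < j := by simpa using hkj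
    refine coeff_eq_zero_of_natDegree_lt ((natDegree_orderPoly_le f n j).trans_lt ?_)
    omega

theorem invModuleAt_zero_eq_colLattice {n : ℕ} {f : Polynomial ℤ} (hn : n ≠ 0)
    (hf : f.natDegree = n) (a : Fin n → ℂ) :
    invModuleAt f a 0 =
      colLattice (powMatrix a * (orderMatrix f n).map (Int.cast : ℤ → ℂ)) := by
  have hcol : ∀ j : Fin n, (fun i => (powMatrix a * (orderMatrix f n).map (Int.cast : ℤ → ℂ)) i j) =
      aeval a (orderPoly f n j) := by
    intro j
    ext i
    rw [aeval_fun_apply, aeval_eq_sum_range' (n := n)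
      ((natDegree_orderPoly_le f n j).trans_lt (by omega)), ← Finset.sum_range_reflect,
      Finset.sum_range, Matrix.mul_apply]
    exact Finset.sum_congr rfl fun k _ => by simp [powMatrix, orderMatrix, mul_comm]
  rw [invModuleAt, colLattice, funext hcol]
  congr 1
  subst hf
  ext y
  simp only [Set.mem_union, Set.mem_ofPred_eq, Set.mem_range]
  constructor
  · rintro (⟨j, hj, rfl⟩ | ⟨i, h1, h2, rfl⟩)
    · obtain rfl : j = 0 := by omega
      exact ⟨⟨f.natDegree - 1, by omega⟩, by simp [orderPoly]⟩
    · refine ⟨⟨f.natDegree - 1 - i, by omega⟩, ?_⟩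
      rw [orderPoly, if_neg (by simp; omega)]
      simp only [show f.natDegree - 1 - (f.natDegree - 1 - i) = i by omega]
      exact aeval_zetaPoly f a i
  · rintro ⟨j, rfl⟩
    by_cases h : (j : ℕ) = f.natDegree - 1
    · exact Or.inl ⟨0, le_rfl, by simp [orderPoly, h]⟩
    · refine Or.inr ⟨f.natDegree - 1 - j, by omega, by omega, ?_⟩
      rw [orderPoly, if_neg h]
      exact aeval_zetaPoly f a _

/-- Two invariant lattices agree up to a scalar `κ` exactly when the power bases are related by
`κ` and a unimodular matrix. -/
theorem invModuleAt_top_eq_iff {n : ℕ} (hn : n ≠ 0) {f g : Polynomial ℤ} (hf : f.natDegree = n)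
    (hg : g.natDegree = n) {θ b : Fin n → ℂ} (hθ : Function.Injective θ) (κ : Fin n → ℂ) :
    (invModuleAt f θ (n - 1) : Set (Fin n → ℂ)) = (fun y => κ * y) '' invModuleAt g b (n - 1) ↔
      ∃ U : Matrix (Fin n) (Fin n) ℤ, IsUnit U.det ∧
        powMatrix θ = Matrix.diagonal κ * powMatrix b * U.map (Int.cast : ℤ → ℂ) := by
  rw [invModuleAt_top_eq_colLattice hn hf, invModuleAt_top_eq_colLattice hn hg,
    image_mul_colLattice, SetLike.coe_set_eq, colLattice_eq_iff (det_powMatrix_ne_zero hθ)]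

theorem det_map_intCast {n : ℕ} (U : Matrix (Fin n) (Fin n) ℤ) :
    (U.map (Int.cast : ℤ → ℂ)).det = (U.det : ℂ) :=
  ((Int.castRingHom ℂ).map_det U).symm

theorem leadingCoeff_pow_mul_prod_eq {n : ℕ} (hn : n ≠ 0) {f g : Polynomial ℤ}
    (hf : f.natDegree = n) (hg : g.natDegree = n) (hf0 : f.leadingCoeff ≠ 0)
    {θ b : Fin n → ℂ} (hθ : Function.Injective θ)
    (hb : Function.Injective b) {κ : Fin n → ℂ}
    (hM : (invModuleAt f θ (n - 1) : Set (Fin n → ℂ)) =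
      (fun y => κ * y) '' invModuleAt g b (n - 1))
    (hR : invModuleAt f θ 0 = invModuleAt g b 0) :
    ∃ ε : ℤ, (ε = 1 ∨ ε = -1) ∧
      (f.leadingCoeff : ℂ) ^ (n - 1) * ∏ i, κ i = ε * (g.leadingCoeff : ℂ) ^ (n - 1) := by
  obtain ⟨U, hU, h1⟩ := (invModuleAt_top_eq_iff hn hf hg hθ κ).1 hM
  rw [invModuleAt_zero_eq_colLattice hn hf, invModuleAt_zero_eq_colLattice hn hg,
    colLattice_eq_iff] at hR
  · obtain ⟨U', hU', h2⟩ := hR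
    have d1 := congrArg Matrix.det h1
    have d2 := congrArg Matrix.det h2
    simp only [Matrix.det_mul, Matrix.det_diagonal, det_map_intCast, det_orderMatrix _ hn] at d1 d2
    rw [Int.isUnit_iff] at hU hU'
    have hb0 := det_powMatrix_ne_zero hb
    rw [Int.cast_pow, Int.cast_pow] at d2
    refine ⟨U.det * U'.det, ?_, mul_left_cancel₀ hb0 ?_⟩
    · rcases hU with h | h <;> rcases hU' with h' | h' <;> simp [h, h']
    · have hsq : (U.det : ℂ) * U.det = 1 := by rcases hU with h | h <;> simp [h]
      rw [d1] at d2
      rw [Int.cast_mul]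
      linear_combination (U.det : ℂ) * d2 -
        (powMatrix b).det * f.leadingCoeff ^ (n - 1) * (∏ i, κ i) * hsq
  · rw [Matrix.det_mul, det_map_intCast, det_orderMatrix _ hn]
    refine mul_ne_zero (det_powMatrix_ne_zero hθ) ?_
    exact_mod_cast pow_ne_zero _ hf0

theorem mem_invModuleAt_zero_iff {n : ℕ} (hn : n ≠ 0) {f : Polynomial ℤ}
    (hf : f.natDegree = n) (hprim : f.IsPrimitive) {θ : Fin n → ℂ} (hθ : Function.Injective θ)
    (hroot : aeval θ f = 0) {y : Fin n → ℂ} :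
    y ∈ invModuleAt f θ 0 ↔
      ∀ m ∈ invModuleAt f θ (n - 1), y * m ∈ invModuleAt f θ (n - 1) :=
  ⟨fun hy _ hm => invModuleAt_zero_mul_mem hn hf hroot hy hm,
    mem_invModuleAt_zero_of_mul_mem hn hf hprim hroot
      fun _ hP => eq_zero_of_aeval_pi_eq_zero (RingHom.injective_int _) hθ hP⟩

theorem invModuleAt_zero_eq_of_isPrimitive {n : ℕ} (hn : n ≠ 0) {f g : Polynomial ℤ}
    (hf : f.natDegree = n) (hg : g.natDegree = n) (hfp : f.IsPrimitive) (hgp : g.IsPrimitive)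
    {θ b : Fin n → ℂ} (hθ : Function.Injective θ) (hb : Function.Injective b)
    (hfθ : aeval θ f = 0) (hgb : aeval b g = 0) {κ : Fin n → ℂ} (hκ : ∀ i, κ i ≠ 0)
    (hM : (invModuleAt f θ (n - 1) : Set (Fin n → ℂ)) =
      (fun y => κ * y) '' invModuleAt g b (n - 1)) :
    invModuleAt f θ 0 = invModuleAt g b 0 := by
  have hmem : ∀ z, z ∈ invModuleAt f θ (n - 1) ↔
      ∃ m ∈ invModuleAt g b (n - 1), κ * m = z := fun z => by
    rw [← SetLike.mem_coe, hM]; rfl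
  have hcancel : Function.Injective fun y : Fin n → ℂ => κ * y := fun y z h => by
    ext i
    exact mul_left_cancel₀ (hκ i) (congrFun h i)
  ext y
  rw [mem_invModuleAt_zero_iff hn hf hfp hθ hfθ, mem_invModuleAt_zero_iff hn hg hgp hb hgb]
  simp only [hmem]
  constructor
  · intro h m hm
    obtain ⟨m', hm', e⟩ := h (κ * m) ⟨m, hm, rfl⟩
    have : m' = y * m := hcancel (by simp only [e]; ring)
    exact this ▸ hm'
  · rintro h _ ⟨m, hm, rfl⟩
    exact ⟨y * m, h m hm, by ring⟩

theorem invModuleAt_zero_eq {n : ℕ} (hn : 2 ≤ n) {f g : Polynomial ℤ}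
    (hf : f.natDegree = n) (hg : g.natDegree = n)
    {θ b : Fin n → ℂ} (hθ : Function.Injective θ) (hb : Function.Injective b)
    (hfθ : aeval θ f = 0) (hgb : aeval b g = 0) {κ : Fin n → ℂ} (hκ : ∀ i, κ i ≠ 0)
    (hM : (invModuleAt f θ (n - 1) : Set (Fin n → ℂ)) =
      (fun y => κ * y) '' invModuleAt g b (n - 1))
    {ε : ℤ} (hε : ε = 1 ∨ ε = -1)
    (hN : (f.leadingCoeff : ℂ) ^ (n - 1) * ∏ i, κ i = ε * (g.leadingCoeff : ℂ) ^ (n - 1)) :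
    invModuleAt f θ 0 = invModuleAt g b 0 := by
  have hn0 : n ≠ 0 := by omega
  have content_ne : ∀ {p : ℤ[X]}, p.natDegree = n → p.content ≠ 0 := fun {p} hp h => by
    rw [content_eq_zero_iff.1 h, natDegree_zero] at hp; omega
  have primPart_root : ∀ {p : ℤ[X]} {x : Fin n → ℂ}, p.natDegree = n → aeval x p = 0 →
      aeval x p.primPart = 0 := fun {p x} hp h => by
    rw [p.eq_C_content_mul_primPart, map_mul, aeval_C] at h
    ext i
    have hi := congrFun h i
    simpa [content_ne hp] using hi
  have hfd := f.natDegree_primPart.trans hf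
  have hgd := g.natDegree_primPart.trans hg
  rw [invModuleAt_top_eq_colLattice hn0 hf, invModuleAt_top_eq_colLattice hn0 hg,
    ← invModuleAt_top_eq_colLattice hn0 hfd, ← invModuleAt_top_eq_colLattice hn0 hgd] at hM
  have hR := invModuleAt_zero_eq_of_isPrimitive hn0 hfd hgd f.isPrimitive_primPart
    g.isPrimitive_primPart hθ hb (primPart_root hf hfθ) (primPart_root hg hgb) hκ hM
  have hlf : f.leadingCoeff = f.content * f.primPart.leadingCoeff := by
    conv_lhs => rw [f.eq_C_content_mul_primPart, leadingCoeff_mul, leadingCoeff_C]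
  have hlg : g.leadingCoeff = g.content * g.primPart.leadingCoeff := by
    conv_lhs => rw [g.eq_C_content_mul_primPart, leadingCoeff_mul, leadingCoeff_C]
  have hf0 : f.primPart.leadingCoeff ≠ 0 := leadingCoeff_ne_zero.2 f.primPart_ne_zero
  have hg0 : g.primPart.leadingCoeff ≠ 0 := leadingCoeff_ne_zero.2 g.primPart_ne_zero
  obtain ⟨δ, hδ, hN'⟩ := leadingCoeff_pow_mul_prod_eq hn0 hfd hgd hf0 hθ hb hM hR
  have hcontent : f.content = g.content := by
    rw [hlf, hlg] at hN
    push_cast at hN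
    rw [mul_pow, mul_assoc, hN'] at hN
    have h1 : (f.content : ℂ) ^ (n - 1) * δ = ε * (g.content : ℂ) ^ (n - 1) := by
      have : (g.primPart.leadingCoeff : ℂ) ^ (n - 1) ≠ 0 :=
        pow_ne_zero _ (by exact_mod_cast hg0)
      refine mul_right_cancel₀ this ?_
      linear_combination hN
    have h2 : f.content ^ (n - 1) * δ = ε * g.content ^ (n - 1) := by exact_mod_cast h1
    have h3 := congrArg Int.natAbs h2
    have hε' : ε.natAbs = 1 := by rcases hε with rfl | rfl <;> rfl
    have hδ' : δ.natAbs = 1 := by rcases hδ with rfl | rfl <;> rfl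
    rw [Int.natAbs_mul, Int.natAbs_mul, Int.natAbs_pow, Int.natAbs_pow, hε', hδ', mul_one,
      one_mul] at h3
    have h4 := Nat.pow_left_injective (n := n - 1) (by omega) h3
    have hnf : 0 ≤ f.content := Int.nonneg_of_normalize_eq_self normalize_content
    have hng : 0 ≤ g.content := Int.nonneg_of_normalize_eq_self normalize_content
    omega
  ext y
  rw [f.eq_C_content_mul_primPart, g.eq_C_content_mul_primPart,
    mem_invModuleAt_C_mul (content_ne hf), mem_invModuleAt_C_mul (content_ne hg), hR, hcontent]

theorem exists_roots_eq_map {n : ℕ} {f : Polynomial ℤ} (hf : f.natDegree = n)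
    (hd : discC f ≠ 0) :
    ∃ a : Fin n → ℂ, Function.Injective a ∧
      (f.map (Int.castRingHom ℂ)).roots = Finset.univ.val.map a := by
  have hlen : (rootList f).length = n := by
    rw [rootList, Multiset.length_toList, ← (IsAlgClosed.splits _).natDegree_eq_card_roots,
      natDegree_map_eq_of_injective Int.cast_injective, hf]
  subst hlen
  refine ⟨(rootList f).get, ?_, ?_⟩
  · have h := Finset.prod_ne_zero_iff.1 (right_ne_zero_of_mul hd)
    have hne : ∀ i j, i < j → (rootList f).get i ≠ (rootList f).get j := fun i j hij e => by
      refine h (i, j) (Finset.mem_univ _) ?_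
      simp only [if_pos (Fin.lt_def.1 hij), e, sub_self, zero_pow two_ne_zero]
    intro i j e
    rcases lt_trichotomy i j with hlt | heq | hlt
    · exact absurd e (hne i j hlt)
    · exact heq
    · exact absurd e.symm (hne j i hlt)
  · rw [Fin.univ_val_map, List.ofFn_get, rootList, Multiset.coe_toList]

theorem mem_range_of_aeval_eq_zero {n : ℕ} {f : Polynomial ℤ} (hf0 : f ≠ 0) {a : Fin n → ℂ}
    (h : (f.map (Int.castRingHom ℂ)).roots = Finset.univ.val.map a) (z : ℂ) :
    aeval z f = 0 ↔ ∃ i, a i = z := by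
  have h0 : f.map (Int.castRingHom ℂ) ≠ 0 :=
    (Polynomial.map_ne_zero_iff Int.cast_injective).2 hf0
  have : z ∈ (f.map (Int.castRingHom ℂ)).roots ↔ ∃ i, a i = z := by
    rw [h]; simp
  rw [← this, mem_roots h0, IsRoot.def, eval_map, aeval_def]
  rfl

/-- The linear form with the given coefficients. -/
noncomputable def linForm {n : ℕ} (v : Fin n → ℂ) : MvPolynomial (Fin n) ℂ :=
  ∑ j, MvPolynomial.C (v j) * MvPolynomial.X j

theorem eval_linForm {n : ℕ} (v x : Fin n → ℂ) : MvPolynomial.eval x (linForm v) = v ⬝ᵥ x := by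
  simp [linForm, dotProduct]

theorem linForm_smul {n : ℕ} (c : ℂ) (v : Fin n → ℂ) :
    linForm (c • v) = MvPolynomial.C c * linForm v := by
  simp [linForm, Finset.mul_sum, mul_assoc]

theorem bind₁_linForm {n : ℕ} (U : Matrix (Fin n) (Fin n) ℂ) (v : Fin n → ℂ) :
    MvPolynomial.bind₁ (fun i => ∑ j, MvPolynomial.C (U i j) * MvPolynomial.X j) (linForm v) =
      linForm (Matrix.vecMul v U) := by
  simp only [linForm, map_sum, map_mul, MvPolynomial.bind₁_C_right, MvPolynomial.bind₁_X_right,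
    Finset.mul_sum, Matrix.vecMul, dotProduct, Finset.sum_mul]
  rw [Finset.sum_comm]
  exact Finset.sum_congr rfl fun _ _ => Finset.sum_congr rfl fun _ _ => (mul_assoc _ _ _).symm

theorem hermiteForm_eq {n : ℕ} {f : Polynomial ℤ} {a : Fin n → ℂ}
    (h : (f.map (Int.castRingHom ℂ)).roots = Finset.univ.val.map a) :
    hermiteForm n f = MvPolynomial.C ((f.leadingCoeff : ℂ) ^ (n - 1)) *
      ∏ i, linForm (powMatrix a i) := by
  rw [hermiteForm, h, Multiset.map_map]
  rfl

theorem bind₁_hermiteForm {n : ℕ} {g : Polynomial ℤ} {b : Fin n → ℂ}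
    (h : (g.map (Int.castRingHom ℂ)).roots = Finset.univ.val.map b)
    (U : Matrix (Fin n) (Fin n) ℤ) :
    MvPolynomial.bind₁
        (fun i : Fin n => ∑ j : Fin n, MvPolynomial.C ((U i j : ℂ)) * MvPolynomial.X j)
        (hermiteForm n g) = MvPolynomial.C ((g.leadingCoeff : ℂ) ^ (n - 1)) *
      ∏ i, linForm ((powMatrix b * U.map (Int.cast : ℤ → ℂ)) i) := by
  rw [hermiteForm_eq h, map_mul, MvPolynomial.bind₁_C_right, map_prod]
  congr 1
  refine Finset.prod_congr rfl fun i _ => ?_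
  exact (bind₁_linForm (U.map (Int.cast : ℤ → ℂ)) (powMatrix b i))

/-- If the zero set of a linear form lies in the union of finitely many hyperplanes, the form is
proportional to one of those defining the hyperplanes. -/
theorem exists_smul_eq_of_dotProduct {n : ℕ} {ι : Type*} [Finite ι] (v : Fin n → ℂ)
    (w : ι → Fin n → ℂ)
    (h : ∀ x, v ⬝ᵥ x = 0 → ∃ j, w j ⬝ᵥ x = 0) : ∃ j, ∃ c : ℂ, w j = c • v := by
  let φ : (Fin n → ℂ) →ₗ[ℂ] Module.Dual ℂ (Fin n → ℂ) := dotProductBilin ℂ ℂ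
  obtain ⟨j, hj⟩ := Subspace.exists_eq_top_of_iUnion_eq_univ (k := ℂ)
    (E := LinearMap.ker (φ v))
    (p := fun j => (LinearMap.ker (φ (w j))).comap (LinearMap.ker (φ v)).subtype) (by
      refine Set.eq_univ_of_forall fun x => ?_
      obtain ⟨j, hj⟩ := h x x.2
      exact Set.mem_iUnion.2 ⟨j, hj⟩)
  refine ⟨j, ?_⟩
  have hle : LinearMap.ker (φ v) ≤ LinearMap.ker (φ (w j)) := fun x hx => by
    have : (⟨x, hx⟩ : LinearMap.ker (φ v)) ∈ (⊤ : Submodule ℂ (LinearMap.ker (φ v))) := trivial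
    rw [← hj] at this
    exact this
  have hspan := mem_span_of_iInf_ker_le_ker (L := fun _ : Unit => φ v) (K := φ (w j))
    (by simpa using hle)
  rw [Set.range_const, Submodule.mem_span_singleton] at hspan
  obtain ⟨c, hc⟩ := hspan
  refine ⟨c, funext fun i => ?_⟩
  have hi := LinearMap.congr_fun hc (Pi.single i 1)
  simpa [φ] using hi.symm

theorem hermiteEquiv_iff_exists_perm {n : ℕ} (hn : n ≠ 0) {f g : Polynomial ℤ}
    (hf0 : f.leadingCoeff ≠ 0) {a b : Fin n → ℂ}
    (hb : Function.Injective b)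
    (hfa : (f.map (Int.castRingHom ℂ)).roots = Finset.univ.val.map a)
    (hgb : (g.map (Int.castRingHom ℂ)).roots = Finset.univ.val.map b) :
    HermiteEquiv n f g ↔ ∃ (σ : Equiv.Perm (Fin n)) (κ : Fin n → ℂ)
      (U : Matrix (Fin n) (Fin n) ℤ) (ε : ℤ), (∀ i, κ i ≠ 0) ∧ IsUnit U.det ∧ (ε = 1 ∨ ε = -1) ∧
      powMatrix (a ∘ σ) = Matrix.diagonal κ * powMatrix b * U.map (Int.cast : ℤ → ℂ) ∧
      (f.leadingCoeff : ℂ) ^ (n - 1) * ∏ i, κ i = ε * (g.leadingCoeff : ℂ) ^ (n - 1) := by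
  have hrow : ∀ (κ : Fin n → ℂ) (N : Matrix (Fin n) (Fin n) ℂ) i,
      (Matrix.diagonal κ * N) i = κ i • N i := fun κ N i => by
    ext j; simp
  constructor
  · rintro ⟨U, ε, hU, hε, h⟩
    have hε0 : (ε : ℂ) ≠ 0 := by rcases hε with rfl | rfl <;> simp
    rw [bind₁_hermiteForm hgb, hermiteForm_eq hfa] at h
    set N := powMatrix b * U.map (Int.cast : ℤ → ℂ) with hN
    have hNdet : IsUnit N.det := by
      rw [hN, Matrix.det_mul, det_map_intCast]
      refine (mul_ne_zero (det_powMatrix_ne_zero hb) ?_).isUnit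
      exact_mod_cast hU.ne_zero
    have heval : ∀ x, (g.leadingCoeff : ℂ) ^ (n - 1) * ∏ i, (N i ⬝ᵥ x) =
        ε * ((f.leadingCoeff : ℂ) ^ (n - 1) * ∏ i, (powMatrix a i ⬝ᵥ x)) := fun x => by
      have := congrArg (MvPolynomial.eval x) h
      simpa only [map_mul, MvPolynomial.eval_C, map_prod, eval_linForm] using this
    have hsolve : ∀ y : Fin n → ℂ, ∃ x, ∀ i, N i ⬝ᵥ x = y i := fun y =>
      ⟨N⁻¹.mulVec y, fun i => by
        have : N.mulVec (N⁻¹.mulVec y) = y := by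
          rw [Matrix.mulVec_mulVec, Matrix.mul_nonsing_inv N hNdet, Matrix.one_mulVec]
        exact congrFun this i⟩
    have hprop : ∀ i, ∃ j, ∃ c : ℂ, powMatrix a j = c • N i := fun i =>
      exists_smul_eq_of_dotProduct (N i) (fun j => powMatrix a j) fun x hx => by
        have hx' := heval x
        rw [Finset.prod_eq_zero (Finset.mem_univ i) hx, mul_zero, eq_comm, mul_eq_zero,
          mul_eq_zero, Finset.prod_eq_zero_iff] at hx'
        rcases hx' with h1 | h1 | ⟨j, -, hj⟩
        · exact absurd h1 hε0
        · exact absurd h1 (pow_ne_zero _ (by exact_mod_cast hf0))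
        · exact ⟨j, hj⟩
    choose τ κ hκ using hprop
    have hκ0 : ∀ i, κ i ≠ 0 := fun i h0 => by
      have := congrFun (hκ i) ⟨n - 1, by omega⟩
      simp [powMatrix, h0] at this
    have hτ : Function.Injective τ := fun i i' e => by
      by_contra hne
      obtain ⟨x, hx⟩ := hsolve (Pi.single i' 1)
      have h1 := hκ i
      rw [e, hκ i'] at h1
      have h2 := congrArg (fun v => v ⬝ᵥ x) h1
      simp [hx, hne, hκ0 i'] at h2
    let σ : Equiv.Perm (Fin n) := Equiv.ofBijective τ (Finite.injective_iff_bijective.1 hτ)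
    refine ⟨σ, κ, U, ε, hκ0, hU, hε, ?_, ?_⟩
    · rw [mul_assoc, ← hN]
      ext i j
      rw [hrow, ← hκ i]
      rfl
    · obtain ⟨x, hx⟩ := hsolve 1
      have h1 := heval x
      have h2 : ∏ i, (powMatrix a i ⬝ᵥ x) = ∏ i, κ i := by
        rw [← Equiv.prod_comp σ]
        refine Finset.prod_congr rfl fun i _ => ?_
        rw [show powMatrix a (σ i) = _ from hκ i, smul_dotProduct, hx]
        simp
      simp only [hx, h2, Pi.one_apply, Finset.prod_const_one, mul_one] at h1
      have hsq : (ε : ℂ) * ε = 1 := by rcases hε with rfl | rfl <;> simp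
      rw [h1, ← mul_assoc, hsq, one_mul]
  · rintro ⟨σ, κ, U, ε, -, hU, hε, h, hκ⟩
    refine ⟨U, ε, hU, hε, ?_⟩
    have hsq : (ε : ℂ) * ε = 1 := by rcases hε with rfl | rfl <;> simp
    have h1 : ∏ i, linForm (powMatrix a i) = MvPolynomial.C (∏ i, κ i) *
        ∏ i, linForm ((powMatrix b * U.map (Int.cast : ℤ → ℂ)) i) := by
      rw [← Equiv.prod_comp σ, map_prod, ← Finset.prod_mul_distrib]
      refine Finset.prod_congr rfl fun i _ => ?_
      rw [← linForm_smul, ← hrow, ← mul_assoc, ← h]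
      rfl
    have h2 : (ε : ℂ) * ((f.leadingCoeff : ℂ) ^ (n - 1) * ∏ i, κ i) =
        (g.leadingCoeff : ℂ) ^ (n - 1) := by
      rw [hκ, ← mul_assoc, hsq, one_mul]
    rw [bind₁_hermiteForm hgb, hermiteForm_eq hfa, h1, ← h2, map_mul, map_mul]
    ring

theorem map_intCast_rat_ne_zero {f : Polynomial ℤ} (hf : f ≠ 0) :
    f.map (Int.castRingHom ℚ) ≠ 0 :=
  (Polynomial.map_ne_zero_iff Int.cast_injective).2 hf

theorem finrank_Kf {f : Polynomial ℤ} (hf : f ≠ 0) : Module.finrank ℚ (Kf f) = f.natDegree := by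
  rw [(AdjoinRoot.powerBasis (map_intCast_rat_ne_zero hf)).finrank, AdjoinRoot.powerBasis_dim,
    natDegree_map_eq_of_injective Int.cast_injective]

theorem finite_Kf {f : Polynomial ℤ} (hf : f ≠ 0) : Module.Finite ℚ (Kf f) :=
  (AdjoinRoot.powerBasis (map_intCast_rat_ne_zero hf)).finite

theorem aeval_rootOf (f : Polynomial ℤ) :
    aeval (rootOf f) (f.map (Int.castRingHom ℚ)) = 0 :=
  AdjoinRoot.eval₂_root _

theorem exists_algHom_rootOf {A : Type*} [CommRing A] [Algebra ℚ A] {f : Polynomial ℤ} {x : A}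
    (hx : aeval x (f.map (Int.castRingHom ℚ)) = 0) : ∃ ψ : Kf f →ₐ[ℚ] A, ψ (rootOf f) = x :=
  ⟨AdjoinRoot.liftAlgHom _ (Algebra.ofId ℚ A) x hx, AdjoinRoot.lift_root (i := algebraMap ℚ A) hx⟩

theorem mem_range_of_aeval_map_eq_zero {n : ℕ} {f : Polynomial ℤ} (hf0 : f ≠ 0) {a : Fin n → ℂ}
    (h : (f.map (Int.castRingHom ℂ)).roots = Finset.univ.val.map a) (z : ℂ) :
    aeval z (f.map (Int.castRingHom ℚ)) = 0 ↔ ∃ i, a i = z := by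
  rw [← mem_range_of_aeval_eq_zero hf0 h, aeval_def, eval₂_map, aeval_def]
  rw [RingHom.ext_int ((algebraMap ℚ ℂ).comp (Int.castRingHom ℚ)) (algebraMap ℤ ℂ)]

theorem exists_aeval_rootOf {f : Polynomial ℤ} (y : Kf f) :
    ∃ P : ℚ[X], aeval (rootOf f) P = y := by
  obtain ⟨P, rfl⟩ := AdjoinRoot.mk_surjective y
  exact ⟨P, AdjoinRoot.aeval_eq P⟩

theorem algHom_injective_of_injective {n : ℕ} {f : Polynomial ℤ} (hf0 : f ≠ 0)
    (hf : f.natDegree = n) {x : Fin n → ℂ} (hx : Function.Injective x)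
    {ψ : Kf f →ₐ[ℚ] (Fin n → ℂ)} (hψ : ψ (rootOf f) = x) : Function.Injective ψ := by
  rw [injective_iff_map_eq_zero]
  intro y hy
  rcases subsingleton_or_nontrivial (Kf f) with h | h
  · exact Subsingleton.elim _ _
  obtain ⟨P, hP, rfl⟩ :=
    (AdjoinRoot.powerBasis (map_intCast_rat_ne_zero hf0)).exists_eq_aeval y
  rw [AdjoinRoot.powerBasis_dim, natDegree_map_eq_of_injective Int.cast_injective, hf] at hP
  rw [AdjoinRoot.powerBasis_gen, ← aeval_algHom_apply] at hy
  have : P = 0 := eq_zero_of_aeval_pi_eq_zero (algebraMap ℚ ℂ).injective hx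
    (mem_degreeLT_of_natDegree_lt hP) (by rw [← hψ]; exact hy)
  rw [this, map_zero]

theorem isUnit_of_isUnit_map {f : Polynomial ℤ} (hf : f ≠ 0) {A : Type*} [CommRing A]
    [Algebra ℚ A] {ψ : Kf f →ₐ[ℚ] A} (hψ : Function.Injective ψ) {y : Kf f}
    (hy : IsUnit (ψ y)) : IsUnit y := by
  have := finite_Kf hf
  have : IsArtinianRing (Kf f) := IsArtinianRing.of_finite ℚ (Kf f)
  refine IsArtinianRing.isUnit_of_mem_nonZeroDivisors (mem_nonZeroDivisors_iff_right.2 ?_)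
  intro z hz
  refine (injective_iff_map_eq_zero ψ).1 hψ z ((hy.mul_left_eq_zero).1 ?_)
  rw [← map_mul, hz, map_zero]

open Pointwise in
theorem image_units_smul {K A : Type*} [CommRing K] [CommRing A] (ψ : K →+* A) (κ : K) (S : Set K) :
    ψ '' (κ • S) = (fun y => ψ κ * y) '' (ψ '' S) := by
  rw [← Set.image_smul, Set.image_image, Set.image_image]
  simp

open Pointwise in
theorem exists_algEquiv_iff_exists_perm {n : ℕ} (hn : 2 ≤ n) {f g : Polynomial ℤ}
    (hf : f.natDegree = n) (hg : g.natDegree = n) {a b : Fin n → ℂ}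
    (ha : Function.Injective a) (hb : Function.Injective b)
    (hfa : (f.map (Int.castRingHom ℂ)).roots = Finset.univ.val.map a)
    (hgb : (g.map (Int.castRingHom ℂ)).roots = Finset.univ.val.map b) :
    (∃ (φ : Kf f ≃ₐ[ℚ] Kf g) (κ : (Kf g)ˣ),
        (φ '' (invModule f 0 : Set (Kf f)) = (invModule g 0 : Set (Kf g))) ∧
        (φ '' (invModule f (n - 1) : Set (Kf f)) =
          (κ : Kf g) • (invModule g (n - 1) : Set (Kf g)))) ↔
      ∃ (σ : Equiv.Perm (Fin n)) (κ : Fin n → ℂ), (∀ i, κ i ≠ 0) ∧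
        invModuleAt f (a ∘ σ) 0 = invModuleAt g b 0 ∧
        (invModuleAt f (a ∘ σ) (n - 1) : Set (Fin n → ℂ)) =
          (fun y => κ * y) '' invModuleAt g b (n - 1) := by
  have hf0 : f ≠ 0 := by rintro rfl; simp at hf; omega
  have hg0 : g ≠ 0 := by rintro rfl; simp at hg; omega
  have hb0 : aeval b (g.map (Int.castRingHom ℚ)) = 0 := funext fun i => by
    rw [aeval_fun_apply]; exact (mem_range_of_aeval_map_eq_zero hg0 hgb _).2 ⟨i, rfl⟩
  obtain ⟨ψ, hψb⟩ := exists_algHom_rootOf (A := Fin n → ℂ) (x := b) hb0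
  have hψ := algHom_injective_of_injective hg0 hg hb hψb
  have himg : ∀ k, ψ '' (invModule g k : Set (Kf g)) = (invModuleAt g b k : Set (Fin n → ℂ)) :=
    fun k => by
      rw [invModule_eq_invModuleAt, ← hψb]
      exact image_invModuleAt (ψ : Kf g →+* (Fin n → ℂ)) g (rootOf g) k
  have himgφ : ∀ (φ : Kf f →ₐ[ℚ] Kf g) k, ψ '' (φ '' (invModule f k : Set (Kf f))) =
      (invModuleAt f (ψ (φ (rootOf f))) k : Set (Fin n → ℂ)) := fun φ k => by
    rw [invModule_eq_invModuleAt, Set.image_image]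
    exact image_invModuleAt ((ψ.comp φ : Kf f →ₐ[ℚ] (Fin n → ℂ)) : Kf f →+* (Fin n → ℂ)) f
      (rootOf f) k
  constructor
  · rintro ⟨φ, κ, hR, hM⟩
    set θ := ψ (φ (rootOf f)) with hθ
    have hθf : ∀ i, ∃ j, a j = θ i := fun i => by
      rw [← mem_range_of_aeval_map_eq_zero hf0 hfa, ← aeval_fun_apply, hθ, aeval_algHom_apply,
        aeval_algEquiv, AlgHom.comp_apply, aeval_rootOf]
      simp
    have hθinj : Function.Injective θ := by
      obtain ⟨P, hP⟩ := exists_aeval_rootOf (φ.symm (rootOf g))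
      have hPb : aeval θ P = b := by
        rw [hθ, aeval_algHom_apply, aeval_algEquiv, AlgHom.comp_apply, hP]
        simp [hψb]
      intro i j hij
      refine hb ?_
      rw [← hPb, aeval_fun_apply, aeval_fun_apply, hij]
    choose σ hσ using hθf
    have hσinj : Function.Injective σ := fun i j e => hθinj (by rw [← hσ i, ← hσ j, e])
    have haσ : a ∘ (Equiv.ofBijective σ (Finite.injective_iff_bijective.1 hσinj)) = θ :=
      funext hσ
    refine ⟨Equiv.ofBijective σ (Finite.injective_iff_bijective.1 hσinj), ψ κ, ?_, ?_, ?_⟩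
    · intro i h
      have := (κ.isUnit.map ψ).map (Pi.evalRingHom (fun _ : Fin n => ℂ) i)
      exact this.ne_zero h
    · rw [haσ]
      refine SetLike.coe_injective ?_
      rw [← himg 0, ← hR]
      exact (himgφ φ 0).symm
    · rw [haσ, ← himg]
      refine (himgφ φ (n - 1)).symm.trans ?_
      refine (congrArg (fun S => ψ '' S) hM).trans ?_
      exact image_units_smul (ψ : Kf g →+* (Fin n → ℂ)) _ _
  · rintro ⟨σ, κ, hκ, hR, hM⟩
    set θ := a ∘ σ with hθ
    have hθinj : Function.Injective θ := ha.comp σ.injective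
    have hmem : ∀ z ∈ invModuleAt f θ (n - 1), ∃ y, κ * ψ y = z := fun z hz => by
      rw [← SetLike.mem_coe, hM, ← himg] at hz
      obtain ⟨_, ⟨y, -, rfl⟩, rfl⟩ := hz
      exact ⟨y, rfl⟩
    obtain ⟨u, hu⟩ := hmem 1 (one_mem_invModuleAt f θ _)
    have huu : IsUnit u := isUnit_of_isUnit_map hg0 hψ (IsUnit.of_mul_eq_one_right _ hu)
    obtain ⟨v, rfl⟩ := huu
    have hκv : κ = ψ (v⁻¹ : (Kf g)ˣ) := by
      have h1 : ψ v * ψ (v⁻¹ : (Kf g)ˣ) = 1 := by rw [← map_mul, Units.mul_inv, map_one]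
      calc κ = κ * (ψ v * ψ (v⁻¹ : (Kf g)ˣ)) := by rw [h1, mul_one]
        _ = _ := by rw [← mul_assoc, hu, one_mul]
    obtain ⟨s, hs⟩ := hmem θ (Submodule.subset_span (Or.inl ⟨1, by omega, (pow_one θ).symm⟩))
    rw [hκv, ← map_mul] at hs
    have ht : aeval ((v⁻¹ : (Kf g)ˣ) * s : Kf g) (f.map (Int.castRingHom ℚ)) = 0 := by
      refine hψ ?_
      rw [← aeval_algHom_apply, hs, map_zero]
      exact funext fun i => (aeval_fun_apply _ _ _).trans
        ((mem_range_of_aeval_map_eq_zero hf0 hfa _).2 ⟨σ i, rfl⟩)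
    obtain ⟨φ, hφ⟩ := exists_algHom_rootOf ht
    have hφinj : Function.Injective φ := by
      have : Function.Injective (ψ.comp φ) :=
        algHom_injective_of_injective hf0 hf hθinj (by rw [AlgHom.comp_apply, hφ, hs])
      exact Function.Injective.of_comp this
    have hφbij : Function.Bijective φ := by
      have := finite_Kf hf0
      have := finite_Kf hg0
      refine ⟨hφinj, (LinearMap.injective_iff_surjective_of_finrank_eq_finrank
        (f := φ.toLinearMap) ?_).1 hφinj⟩
      rw [finrank_Kf hf0, finrank_Kf hg0, hf, hg]
    refine ⟨AlgEquiv.ofBijective φ hφbij, v⁻¹, ?_, ?_⟩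
    · refine (Set.image_injective.2 hψ) ?_
      rw [himg, ← hR, ← hs, ← hφ]
      exact himgφ φ 0
    · refine (Set.image_injective.2 hψ) ?_
      refine (himgφ φ _).trans ?_
      rw [hφ, hs, hM, hκv, ← himg]
      exact (image_units_smul (ψ : Kf g →+* (Fin n → ℂ)) _ _).symm

open Pointwise in
/-- `f` and `g` (degree `n ≥ 2`, nonzero discriminant) are Hermite
equivalent iff there are a ℚ-algebra isomorphism `φ : K_f ≃ K_g` and a unit
`κ ∈ K_g^×` with `φ(R_f) = R_g` and `φ(I_f(n-1)) = κ·I_g(n-1)`. -/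
theorem hermiteEquiv_iff_invModule (n : ℕ) (hn : 2 ≤ n) (f g : Polynomial ℤ)
    (hfn : f.natDegree = n) (hgn : g.natDegree = n)
    (hdf : discC f ≠ 0) (hdg : discC g ≠ 0) :
    HermiteEquiv n f g ↔
      ∃ (φ : Kf f ≃ₐ[ℚ] Kf g) (κ : (Kf g)ˣ),
        (φ '' (invModule f 0 : Set (Kf f)) = (invModule g 0 : Set (Kf g))) ∧
        (φ '' (invModule f (n - 1) : Set (Kf f)) =
          (κ : Kf g) • (invModule g (n - 1) : Set (Kf g))) := by
  have hn0 : n ≠ 0 := by omega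
  have hf0 : f.leadingCoeff ≠ 0 := leadingCoeff_ne_zero.2 (by rintro rfl; simp at hfn; omega)
  have hg0 : g.leadingCoeff ≠ 0 := leadingCoeff_ne_zero.2 (by rintro rfl; simp at hgn; omega)
  obtain ⟨a, ha, hfa⟩ := exists_roots_eq_map hfn hdf
  obtain ⟨b, hb, hgb⟩ := exists_roots_eq_map hgn hdg
  rw [hermiteEquiv_iff_exists_perm hn0 hf0 hb hfa hgb,
    exists_algEquiv_iff_exists_perm hn hfn hgn ha hb hfa hgb]
  constructor
  · rintro ⟨σ, κ, U, ε, hκ, hU, hε, hP, hN⟩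
    have haσ := ha.comp σ.injective
    have hM := (invModuleAt_top_eq_iff hn0 hfn hgn haσ κ).2 ⟨U, hU, hP⟩
    refine ⟨σ, κ, hκ, invModuleAt_zero_eq hn hfn hgn haσ hb ?_ ?_ hκ hM hε hN, hM⟩
    · exact funext fun i => (aeval_fun_apply _ _ _).trans
        ((mem_range_of_aeval_eq_zero (leadingCoeff_ne_zero.1 hf0) hfa _).2 ⟨σ i, rfl⟩)
    · exact funext fun i => (aeval_fun_apply _ _ _).trans
        ((mem_range_of_aeval_eq_zero (leadingCoeff_ne_zero.1 hg0) hgb _).2 ⟨i, rfl⟩)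
  · rintro ⟨σ, κ, hκ, hR, hM⟩
    have haσ := ha.comp σ.injective
    obtain ⟨U, hU, hP⟩ := (invModuleAt_top_eq_iff hn0 hfn hgn haσ κ).1 hM
    obtain ⟨ε, hε, hN⟩ := leadingCoeff_pow_mul_prod_eq hn0 hfn hgn hf0 haσ hb hM hR
    exact ⟨σ, κ, U, ε, hκ, hU, hε, hP, hN⟩
end

section
/- Let f, g ∈ ℤ[X] be primitive polynomials of degree n ≥ 2 with nonzero discriminant. Then f and g are Hermite equivalent if and only if there exist a ℚ-algebra isomorphism φ : K_f → K_g and a unit κ ∈ K_g^× such that φ maps R_f onto R_g and φ maps the invariant ideal I_f onto κ·I_g, where κ·I_g denotes the ℤ-submodule {κ·x : x ∈ I_g} of K_g. -/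
open Polynomial

/-- The coefficients of `f(X)/(X - α)`, from the top degree down:
`eulerElt f i = f₀ αⁱ + f₁ α^(i-1) + ⋯ + fᵢ`. -/
noncomputable def eulerElt (f : ℤ[X]) (i : ℕ) : Kf f :=
  zeta f i + ((f.coeff (f.natDegree - i) : ℤ) : Kf f)

/-- The ℤ-span of `1, α, …, α^(n-1)`. -/
noncomputable def powModule (f : ℤ[X]) : Submodule ℤ (Kf f) :=
  Submodule.span ℤ (Set.range fun j : Fin f.natDegree => rootOf f ^ (j : ℕ))

/-- The ℤ-span of the coefficients of `f(X)/(X - α)`. -/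
noncomputable def eulerModule (f : ℤ[X]) : Submodule ℤ (Kf f) :=
  Submodule.span ℤ (Set.range fun j : Fin f.natDegree => eulerElt f j)

theorem zeta_zero (f : ℤ[X]) : zeta f 0 = 0 := by simp [zeta]

theorem zeta_succ (f : ℤ[X]) (i : ℕ) : zeta f (i + 1) = rootOf f * eulerElt f i := by
  rw [eulerElt, zeta, zeta, Finset.sum_range_succ, mul_add, Finset.mul_sum]
  congr 1
  · refine Finset.sum_congr rfl fun j hj => ?_
    rw [Finset.mem_range] at hj
    rw [show i + 1 - j = (i - j) + 1 by omega, pow_succ]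
    ring
  · rw [show i + 1 - i = 1 by omega, pow_one, mul_comm]

theorem eulerElt_eq_sum (f : ℤ[X]) (i : ℕ) :
    eulerElt f i = ∑ j ∈ Finset.range (i + 1),
      ((f.coeff (f.natDegree - j) : ℤ) : Kf f) * rootOf f ^ (i - j) := by
  rw [eulerElt, zeta, Finset.sum_range_succ, Nat.sub_self, pow_zero, mul_one]

theorem sum_coeff_mul_rootOf_pow (f : ℤ[X]) :
    ∑ j ∈ Finset.range (f.natDegree + 1), ((f.coeff j : ℤ) : Kf f) * rootOf f ^ j = 0 := by
  have h : aeval (rootOf f) (f.map (Int.castRingHom ℚ)) = 0 := by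
    rw [rootOf, AdjoinRoot.aeval_eq, AdjoinRoot.mk_self]
  rw [aeval_def, eval₂_map, eval₂_eq_sum_range] at h
  simpa using h

theorem eulerElt_natDegree (f : ℤ[X]) : eulerElt f f.natDegree = 0 := by
  rw [eulerElt_eq_sum, ← sum_coeff_mul_rootOf_pow f, ← Finset.sum_range_reflect]
  refine Finset.sum_congr rfl fun j hj => ?_
  rw [Finset.mem_range] at hj
  rw [show f.natDegree - (f.natDegree + 1 - 1 - j) = j by omega]

theorem map_intCast_ne_zero {f : ℤ[X]} (hf : f ≠ 0) : f.map (Int.castRingHom ℚ) ≠ 0 :=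
  (Polynomial.map_ne_zero_iff (RingHom.injective_int _)).2 hf

theorem natDegree_map_intCast (f : ℤ[X]) : (f.map (Int.castRingHom ℚ)).natDegree = f.natDegree :=
  natDegree_map_eq_of_injective (RingHom.injective_int _) f

/-- The ℚ-basis `1, α, …, α^(n-1)` of `K_f`. -/
noncomputable def powBasis (f : ℤ[X]) (hf : f ≠ 0) : Module.Basis (Fin f.natDegree) ℚ (Kf f) :=
  (AdjoinRoot.powerBasis (map_intCast_ne_zero hf)).basis.reindex
    (finCongr (natDegree_map_intCast f))

theorem powBasis_apply (f : ℤ[X]) (hf : f ≠ 0) (j : Fin f.natDegree) :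
    powBasis f hf j = rootOf f ^ (j : ℕ) := by
  simp only [powBasis, rootOf, Module.Basis.reindex_apply, PowerBasis.coe_basis,
    AdjoinRoot.powerBasis_gen]
  rfl

theorem exists_dual_functional (f : ℤ[X]) (hf : f ≠ 0) (hpos : 0 < f.natDegree) :
    ∃ θ : Kf f →ₗ[ℚ] ℚ, ∀ j < f.natDegree, ∀ i < f.natDegree,
      θ (rootOf f ^ j * eulerElt f i) = if i + j = f.natDegree - 1 then 1 else 0 := by
  set n := f.natDegree with hn
  set τ : Kf f →ₗ[ℚ] ℚ := (powBasis f hf).coord ⟨n - 1, by omega⟩ with hτdef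
  have hτ : ∀ j < n, τ (rootOf f ^ j) = if j = n - 1 then 1 else 0 := by
    intro j hj
    have := powBasis_apply f hf ⟨j, hj⟩
    rw [← this, hτdef, Module.Basis.coord_apply, Module.Basis.repr_self, Finsupp.single_apply]
    simp [Fin.ext_iff]
  have hz : ∀ (z : ℤ) (x : Kf f), τ ((z : Kf f) * x) = z * τ x := by
    intro z x
    rw [← zsmul_eq_mul, map_zsmul, zsmul_eq_mul]
  have key : ∀ j < n, ∀ i ≤ n, τ (rootOf f ^ j * eulerElt f i) =
      if i + j = n - 1 then (f.leadingCoeff : ℚ) else 0 := by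
    intro j
    induction j with
    | zero =>
      intro _ i hi
      rcases hi.lt_or_eq with hi | rfl
      · rw [pow_zero, one_mul, eulerElt_eq_sum, map_sum, Finset.sum_range_succ']
        rw [Finset.sum_eq_zero]
        · simp only [hz, zero_add, Nat.sub_zero, add_zero]
          rw [hτ i hi]
          simp [← hn, leadingCoeff]
        · intro k hk
          rw [Finset.mem_range] at hk
          rw [hz, hτ _ (by omega), if_neg (by omega), mul_zero]
      · rw [hn, eulerElt_natDegree, mul_zero, map_zero, if_neg (by omega)]
    | succ j ih =>
      intro hj i hi
      rcases hi.lt_or_eq with hi | rfl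
      · have h1 : rootOf f ^ (j + 1) * eulerElt f i = rootOf f ^ j * eulerElt f (i + 1) -
            ((f.coeff (f.natDegree - (i + 1)) : ℤ) : Kf f) * rootOf f ^ j := by
          rw [eulerElt.eq_1 f (i + 1), zeta_succ]
          ring
        rw [h1, map_sub, ih (by omega) (i + 1) hi, hz, hτ j (by omega),
          if_neg (by omega : ¬ j = n - 1), mul_zero, sub_zero]
        simp only [show i + 1 + j = i + (j + 1) by omega]
      · rw [hn, eulerElt_natDegree, mul_zero, map_zero, if_neg (by omega)]
  have hc : (f.leadingCoeff : ℚ) ≠ 0 := by exact_mod_cast leadingCoeff_ne_zero.2 hf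
  refine ⟨(f.leadingCoeff : ℚ)⁻¹ • τ, fun j hj i hi => ?_⟩
  rw [LinearMap.smul_apply, key j hj i hi.le]
  split_ifs <;> simp [hc]

/-- A functional `θ` for which the powers of `α` and the elements `eulerElt f i` are dual bases. -/
noncomputable def dualFunctional (f : ℤ[X]) (hf : f ≠ 0) (hpos : 0 < f.natDegree) :
    Kf f →ₗ[ℚ] ℚ :=
  (exists_dual_functional f hf hpos).choose

section Duality

variable {f : ℤ[X]} (hf : f ≠ 0) (hpos : 0 < f.natDegree)

theorem dualFunctional_apply {j i : ℕ} (hj : j < f.natDegree) (hi : i < f.natDegree) :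
    dualFunctional f hf hpos (rootOf f ^ j * eulerElt f i) =
      if i + j = f.natDegree - 1 then 1 else 0 :=
  (exists_dual_functional f hf hpos).choose_spec j hj i hi

theorem eq_sum_dualFunctional_smul_pow (x : Kf f) :
    x = ∑ j : Fin f.natDegree,
      dualFunctional f hf hpos (x * eulerElt f (f.natDegree - 1 - j)) • rootOf f ^ (j : ℕ) := by
  have h := (powBasis f hf).sum_repr x
  simp only [powBasis_apply] at h
  conv_lhs => rw [← h]
  refine Finset.sum_congr rfl fun j _ => ?_
  congr 1
  conv_rhs => rw [← h, Finset.sum_mul, map_sum]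
  rw [Finset.sum_eq_single j]
  · rw [smul_mul_assoc, map_smul, dualFunctional_apply hf hpos j.2 (by omega), if_pos (by omega),
      smul_eq_mul, mul_one]
  · intro k _ hk
    have : (k : ℕ) ≠ j := fun h => hk (Fin.ext h)
    rw [smul_mul_assoc, map_smul, dualFunctional_apply hf hpos k.2 (by omega), if_neg (by omega),
      smul_zero]
  · simp

theorem eq_zero_of_dualFunctional {x : Kf f} (h : ∀ y, dualFunctional f hf hpos (x * y) = 0) :
    x = 0 := by
  rw [eq_sum_dualFunctional_smul_pow hf hpos x]
  simp [h]

theorem eq_sum_dualFunctional_smul_eulerElt (x : Kf f) :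
    x = ∑ j : Fin f.natDegree,
      dualFunctional f hf hpos (rootOf f ^ (f.natDegree - 1 - j) * x) • eulerElt f j := by
  rw [← sub_eq_zero]
  refine eq_zero_of_dualFunctional hf hpos fun y => ?_
  rw [mul_comm, eq_sum_dualFunctional_smul_pow hf hpos y, Finset.sum_mul, map_sum]
  refine Finset.sum_eq_zero fun k _ => ?_
  rw [smul_mul_assoc, map_smul, mul_sub, map_sub, Finset.mul_sum, map_sum,
    Finset.sum_eq_single (Fin.rev k)]
  · rw [mul_smul_comm, map_smul, dualFunctional_apply hf hpos k.2 (Fin.rev k).2, Fin.val_rev,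
      if_pos (by omega), show f.natDegree - 1 - (f.natDegree - (k + 1)) = k by omega]
    simp
  · intro j _ hj
    have : (j : ℕ) ≠ f.natDegree - (k + 1) := fun h => hj (Fin.ext (by rw [h, Fin.val_rev]))
    rw [mul_smul_comm, map_smul, dualFunctional_apply hf hpos k.2 j.2, if_neg (by omega),
      smul_zero]
  · simp

theorem intCast_smul_mem {K : Type*} [CommRing K] [Algebra ℚ K] (N : Submodule ℤ K) {x : K}
    (hx : x ∈ N) {q : ℚ} (hq : ∃ z : ℤ, q = z) : q • x ∈ N := by
  obtain ⟨z, rfl⟩ := hq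
  rw [Int.cast_smul_eq_zsmul]
  exact N.smul_mem z hx

theorem dualFunctional_mul_mem_int {x y : Kf f} (hx : x ∈ powModule f) (hy : y ∈ eulerModule f) :
    ∃ z : ℤ, dualFunctional f hf hpos (x * y) = z := by
  induction hx using Submodule.span_induction with
  | mem x hx =>
    obtain ⟨j, rfl⟩ := hx
    induction hy using Submodule.span_induction with
    | mem y hy =>
      obtain ⟨i, rfl⟩ := hy
      rw [dualFunctional_apply hf hpos j.2 i.2]
      split_ifs
      exacts [⟨1, by simp⟩, ⟨0, by simp⟩]
    | zero => exact ⟨0, by simp⟩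
    | add y z _ _ hy hz =>
      obtain ⟨a, ha⟩ := hy
      obtain ⟨b, hb⟩ := hz
      exact ⟨a + b, by rw [mul_add, map_add, ha, hb, Int.cast_add]⟩
    | smul c y _ hy =>
      obtain ⟨a, ha⟩ := hy
      exact ⟨c * a, by rw [mul_smul_comm, map_zsmul, ha, zsmul_eq_mul, Int.cast_mul]⟩
  | zero => exact ⟨0, by simp⟩
  | add y z _ _ hy hz =>
    obtain ⟨a, ha⟩ := hy
    obtain ⟨b, hb⟩ := hz
    exact ⟨a + b, by rw [add_mul, map_add, ha, hb, Int.cast_add]⟩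
  | smul c y _ hy =>
    obtain ⟨a, ha⟩ := hy
    exact ⟨c * a, by rw [smul_mul_assoc, map_zsmul, ha, zsmul_eq_mul, Int.cast_mul]⟩

theorem rootOf_pow_mem_powModule {f : ℤ[X]} {j : ℕ} (hj : j < f.natDegree) :
    rootOf f ^ j ∈ powModule f :=
  Submodule.subset_span ⟨⟨j, hj⟩, rfl⟩

theorem eulerElt_mem_eulerModule {f : ℤ[X]} {j : ℕ} (hj : j < f.natDegree) :
    eulerElt f j ∈ eulerModule f :=
  Submodule.subset_span ⟨⟨j, hj⟩, rfl⟩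

theorem mem_powModule_iff (x : Kf f) :
    x ∈ powModule f ↔ ∀ y ∈ eulerModule f, ∃ z : ℤ, dualFunctional f hf hpos (x * y) = z := by
  refine ⟨fun hx y hy => dualFunctional_mul_mem_int hf hpos hx hy, fun h => ?_⟩
  rw [eq_sum_dualFunctional_smul_pow hf hpos x]
  exact sum_mem fun j _ => intCast_smul_mem _ (rootOf_pow_mem_powModule j.2)
    (h _ (eulerElt_mem_eulerModule (by omega)))

theorem mem_eulerModule_iff (y : Kf f) :
    y ∈ eulerModule f ↔ ∀ x ∈ powModule f, ∃ z : ℤ, dualFunctional f hf hpos (x * y) = z := by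
  refine ⟨fun hy x hx => dualFunctional_mul_mem_int hf hpos hx hy, fun h => ?_⟩
  rw [eq_sum_dualFunctional_smul_eulerElt hf hpos y]
  exact sum_mem fun j _ => intCast_smul_mem _ (eulerElt_mem_eulerModule j.2)
    (h _ (rootOf_pow_mem_powModule (by omega)))

end Duality

theorem mul_mem_of_mem_span {K : Type*} [CommRing K] {S T : Set K} {N : Submodule ℤ K}
    (h : ∀ s ∈ S, ∀ t ∈ T, s * t ∈ N) {x y : K} (hx : x ∈ Submodule.span ℤ S)
    (hy : y ∈ Submodule.span ℤ T) : x * y ∈ N := by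
  induction hx using Submodule.span_induction with
  | mem x hx =>
    induction hy using Submodule.span_induction with
    | mem y hy => exact h x hx y hy
    | zero => rw [mul_zero]; exact N.zero_mem
    | add y z _ _ hy hz => rw [mul_add]; exact N.add_mem hy hz
    | smul c y _ hy => rw [mul_smul_comm]; exact N.smul_mem c hy
  | zero => rw [zero_mul]; exact N.zero_mem
  | add y z _ _ hy hz => rw [add_mul]; exact N.add_mem hy hz
  | smul c y _ hy => rw [smul_mul_assoc]; exact N.smul_mem c hy

theorem intCast_mul_mem {K : Type*} [CommRing K] (N : Submodule ℤ K) (z : ℤ) {x : K}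
    (hx : x ∈ N) : (z : K) * x ∈ N := by
  rw [← zsmul_eq_mul]
  exact N.smul_mem z hx

section InvModule

variable {f : ℤ[X]}

theorem one_mem_invModule (k : ℕ) : (1 : Kf f) ∈ invModule f k :=
  Submodule.subset_span (Or.inl ⟨0, Nat.zero_le k, (pow_zero _).symm⟩)

theorem rootOf_mem_invModule_one : rootOf f ∈ invModule f 1 :=
  Submodule.subset_span (Or.inl ⟨1, le_rfl, (pow_one _).symm⟩)

theorem intCast_mem_invModule (k : ℕ) (z : ℤ) : (z : Kf f) ∈ invModule f k := by
  simpa using intCast_mul_mem _ z (one_mem_invModule (f := f) k)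

theorem zeta_natDegree (f : ℤ[X]) : zeta f f.natDegree = -((f.coeff 0 : ℤ) : Kf f) := by
  have h := eulerElt_natDegree f
  rw [eulerElt, Nat.sub_self] at h
  exact eq_neg_of_add_eq_zero_left h

theorem zeta_mem_invModule_zero {i : ℕ} (hi : i ≤ f.natDegree) : zeta f i ∈ invModule f 0 := by
  rcases Nat.eq_zero_or_pos i with rfl | h0
  · rw [zeta_zero]
    exact zero_mem _
  rcases hi.lt_or_eq with h | rfl
  · exact Submodule.subset_span (Or.inr ⟨i, by omega, by omega, rfl⟩)
  · rw [zeta_natDegree]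
    exact neg_mem (intCast_mem_invModule 0 _)

theorem zeta_mem_invModule_one {i : ℕ} (hi : i ≤ f.natDegree) : zeta f i ∈ invModule f 1 := by
  rcases Nat.lt_or_ge 1 i with h1 | h1
  · rcases hi.lt_or_eq with h | rfl
    · exact Submodule.subset_span (Or.inr ⟨i, by omega, by omega, rfl⟩)
    · rw [zeta_natDegree]
      exact neg_mem (intCast_mem_invModule 1 _)
  · interval_cases i
    · rw [zeta_zero]
      exact zero_mem _
    · rw [zeta_succ, eulerElt, zeta_zero, zero_add, mul_comm]
      exact intCast_mul_mem _ _ rootOf_mem_invModule_one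

theorem invModule_zero_induction {N : Submodule ℤ (Kf f)} (h1 : 1 ∈ N)
    (hz : ∀ i ≤ f.natDegree, zeta f i ∈ N) : invModule f 0 ≤ N := by
  refine Submodule.span_le.2 ?_
  rintro x (⟨j, hj, rfl⟩ | ⟨i, _, hi, rfl⟩)
  · rw [Nat.le_zero.1 hj, pow_zero]
    exact h1
  · exact hz i (by omega)

theorem invModule_zero_le_one : invModule f 0 ≤ invModule f 1 :=
  invModule_zero_induction (one_mem_invModule 1) fun _ hi => zeta_mem_invModule_one hi

theorem rootOf_mul_mem_invModule_one {x : Kf f} (hx : x ∈ invModule f 0) :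
    rootOf f * x ∈ invModule f 1 := by
  have h : invModule f 0 ≤
      (invModule f 1).comap (AddMonoidHom.mulLeft (rootOf f)).toIntLinearMap := by
    refine invModule_zero_induction ?_ fun i hi => ?_
    · simpa using rootOf_mem_invModule_one
    · change rootOf f * zeta f i ∈ invModule f 1
      have h1 : rootOf f * zeta f i = rootOf f * eulerElt f i -
          ((f.coeff (f.natDegree - i) : ℤ) : Kf f) * rootOf f := by
        rw [eulerElt]
        ring
      rw [h1]
      refine sub_mem ?_ (intCast_mul_mem _ _ rootOf_mem_invModule_one)
      rcases hi.lt_or_eq with h | rfl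
      · rw [← zeta_succ]
        exact zeta_mem_invModule_one h
      · rw [eulerElt_natDegree, mul_zero]
        exact zero_mem _
  exact h hx

theorem eulerModule_le_invModule_zero : eulerModule f ≤ invModule f 0 := by
  refine Submodule.span_le.2 ?_
  rintro _ ⟨i, rfl⟩
  exact add_mem (zeta_mem_invModule_zero i.2.le) (intCast_mem_invModule 0 _)

theorem rootOf_mul_mem_invModule_zero {x : Kf f} (hx : x ∈ eulerModule f) :
    rootOf f * x ∈ invModule f 0 := by
  have h : eulerModule f ≤
      (invModule f 0).comap (AddMonoidHom.mulLeft (rootOf f)).toIntLinearMap := by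
    refine Submodule.span_le.2 ?_
    rintro _ ⟨i, rfl⟩
    change rootOf f * eulerElt f i ∈ invModule f 0
    rw [← zeta_succ]
    exact zeta_mem_invModule_zero i.2
  exact h hx

theorem rootOf_pow_mul_eulerElt_mem {j : ℕ} (hj : j < f.natDegree) {i : ℕ}
    (hi : i ≤ f.natDegree) : rootOf f ^ j * eulerElt f i ∈ powModule f := by
  induction j generalizing i with
  | zero =>
    rcases hi.lt_or_eq with hi | rfl
    · rw [pow_zero, one_mul, eulerElt_eq_sum]
      refine sum_mem fun k _ => intCast_mul_mem _ _ (rootOf_pow_mem_powModule (by omega))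
    · rw [eulerElt_natDegree, mul_zero]
      exact zero_mem _
  | succ j ih =>
    rcases hi.lt_or_eq with hi | rfl
    · have h1 : rootOf f ^ (j + 1) * eulerElt f i = rootOf f ^ j * eulerElt f (i + 1) -
          ((f.coeff (f.natDegree - (i + 1)) : ℤ) : Kf f) * rootOf f ^ j := by
        rw [eulerElt.eq_1 f (i + 1), zeta_succ]
        ring
      rw [h1]
      exact sub_mem (ih (by omega) hi)
        (intCast_mul_mem _ _ (rootOf_pow_mem_powModule (by omega)))
    · rw [eulerElt_natDegree, mul_zero]
      exact zero_mem _

theorem mul_mem_powModule {x y : Kf f} (hx : x ∈ invModule f 0) (hy : y ∈ powModule f) :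
    x * y ∈ powModule f := by
  refine mul_mem_of_mem_span ?_ hx hy
  rintro s (⟨j, hj, rfl⟩ | ⟨i, _, hi, rfl⟩) _ ⟨k, rfl⟩
  · rw [Nat.le_zero.1 hj, pow_zero, one_mul]
    exact rootOf_pow_mem_powModule k.2
  · have h1 : zeta f i * rootOf f ^ (k : ℕ) = rootOf f ^ (k : ℕ) * eulerElt f i -
        ((f.coeff (f.natDegree - i) : ℤ) : Kf f) * rootOf f ^ (k : ℕ) := by
      rw [eulerElt]
      ring
    rw [h1]
    exact sub_mem (rootOf_pow_mul_eulerElt_mem k.2 (by omega))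
      (intCast_mul_mem _ _ (rootOf_pow_mem_powModule k.2))

theorem mul_mem_eulerModule (hf : f ≠ 0) (hpos : 0 < f.natDegree) {x y : Kf f}
    (hx : x ∈ invModule f 0) (hy : y ∈ eulerModule f) : x * y ∈ eulerModule f := by
  rw [mem_eulerModule_iff hf hpos] at hy ⊢
  intro m hm
  rw [← mul_assoc, mul_comm m x]
  exact hy _ (mul_mem_powModule hx hm)

/-- The ideal `(1, α)` times `eulerModule f` contains `1` when `f` is primitive. -/
theorem exists_add_rootOf_mul_eq_one (hc : f.content = 1) :
    ∃ β ∈ eulerModule f, ∃ γ ∈ eulerModule f, β + rootOf f * γ = 1 := by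
  set N : Submodule ℤ (Kf f) := eulerModule f ⊔
    (eulerModule f).map (AddMonoidHom.mulLeft (rootOf f)).toIntLinearMap with hN
  have hmap : ∀ i < f.natDegree, rootOf f * eulerElt f i ∈ N := fun i hi =>
    Submodule.mem_sup_right ⟨_, eulerElt_mem_eulerModule hi, rfl⟩
  have hzeta : ∀ i ≤ f.natDegree, zeta f i ∈ N := by
    intro i hi
    cases i with
    | zero => rw [zeta_zero]; exact zero_mem _
    | succ i => rw [zeta_succ]; exact hmap i hi
  have hcoeff : ∀ i ≤ f.natDegree, ((f.coeff (f.natDegree - i) : ℤ) : Kf f) ∈ N := by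
    intro i hi
    have h1 : ((f.coeff (f.natDegree - i) : ℤ) : Kf f) = eulerElt f i - zeta f i := by
      rw [eulerElt]
      ring
    rw [h1]
    refine sub_mem ?_ (hzeta i hi)
    rcases hi.lt_or_eq with h | rfl
    · exact Submodule.mem_sup_left (eulerElt_mem_eulerModule h)
    · rw [eulerElt_natDegree]
      exact zero_mem _
  let J : Ideal ℤ := N.comap (Int.castAddHom (Kf f)).toIntLinearMap
  have hJ : ∀ k, f.coeff k ∈ J := by
    intro k
    rcases le_or_gt k f.natDegree with h | h
    · have := hcoeff (f.natDegree - k) (by omega)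
      rwa [show f.natDegree - (f.natDegree - k) = k by omega] at this
    · rw [coeff_eq_zero_of_natDegree_lt h]
      exact zero_mem _
  have hone : (1 : ℤ) ∈ J := by
    have hd : Submodule.IsPrincipal.generator J ∣ f.content := by
      rw [dvd_content_iff_C_dvd, C_dvd_iff_dvd_coeff]
      exact fun k => (Submodule.IsPrincipal.mem_iff_generator_dvd J).1 (hJ k)
    rw [hc] at hd
    exact (Submodule.IsPrincipal.mem_iff_generator_dvd J).2 hd
  have hone' : (1 : Kf f) ∈ N := by
    have : ((1 : ℤ) : Kf f) ∈ N := hone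
    simpa using this
  obtain ⟨β, hβ, _, ⟨γ, hγ, rfl⟩, h⟩ := Submodule.mem_sup.1 hone'
  exact ⟨β, hβ, γ, hγ, h⟩

theorem mem_invModule_zero_iff (hc : f.content = 1) (hpos : 0 < f.natDegree) (x : Kf f) :
    x ∈ invModule f 0 ↔ ∀ y ∈ eulerModule f, x * y ∈ eulerModule f := by
  have hf : f ≠ 0 := by rintro rfl; simp at hpos
  refine ⟨fun hx y hy => mul_mem_eulerModule hf hpos hx hy, fun h => ?_⟩
  obtain ⟨β, hβ, γ, hγ, h1⟩ := exists_add_rootOf_mul_eq_one hc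
  rw [← mul_one x, ← h1, mul_add, mul_left_comm]
  exact add_mem (eulerModule_le_invModule_zero (h β hβ)) (rootOf_mul_mem_invModule_zero (h γ hγ))

theorem mul_mem_invModule_zero (hf : f ≠ 0) (hpos : 0 < f.natDegree) {x y : Kf f}
    (hx : x ∈ invModule f 1) (hy : y ∈ eulerModule f) : x * y ∈ invModule f 0 := by
  have h : invModule f 1 ≤
      (invModule f 0).comap (AddMonoidHom.mulRight y).toIntLinearMap := by
    refine Submodule.span_le.2 ?_
    rintro s (⟨j, hj, rfl⟩ | ⟨i, _, hi, rfl⟩)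
    · change rootOf f ^ j * y ∈ invModule f 0
      interval_cases j
      · rw [pow_zero, one_mul]
        exact eulerModule_le_invModule_zero hy
      · rw [pow_one]
        exact rootOf_mul_mem_invModule_zero hy
    · exact eulerModule_le_invModule_zero
        (mul_mem_eulerModule hf hpos (zeta_mem_invModule_zero (by omega)) hy)
  exact h hx

theorem mem_invModule_one_iff (hc : f.content = 1) (hpos : 0 < f.natDegree) (x : Kf f) :
    x ∈ invModule f 1 ↔ ∀ y ∈ eulerModule f, x * y ∈ invModule f 0 := by
  have hf : f ≠ 0 := by rintro rfl; simp at hpos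
  refine ⟨fun hx y hy => mul_mem_invModule_zero hf hpos hx hy, fun h => ?_⟩
  obtain ⟨β, hβ, γ, hγ, h1⟩ := exists_add_rootOf_mul_eq_one hc
  rw [← mul_one x, ← h1, mul_add, mul_left_comm]
  exact add_mem (invModule_zero_le_one (h β hβ)) (rootOf_mul_mem_invModule_one (h γ hγ))

theorem mem_eulerModule_iff_invModule (hc : f.content = 1) (hpos : 0 < f.natDegree) (x : Kf f) :
    x ∈ eulerModule f ↔ ∀ y ∈ invModule f 1, x * y ∈ invModule f 0 := by
  have hf : f ≠ 0 := by rintro rfl; simp at hpos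
  refine ⟨fun hx y hy => mul_comm y x ▸ mul_mem_invModule_zero hf hpos hy hx, fun h => ?_⟩
  obtain ⟨β, hβ, γ, hγ, h1⟩ := exists_add_rootOf_mul_eq_one hc
  have hx1 := h 1 (one_mem_invModule 1)
  rw [mul_one] at hx1
  rw [← mul_one x, ← h1, mul_add, ← mul_assoc]
  exact add_mem (mul_mem_eulerModule hf hpos hx1 hβ)
    (mul_mem_eulerModule hf hpos (h _ rootOf_mem_invModule_one) hγ)

end InvModule

/-- `φ` maps `N` onto `u⁻¹ • N'`. -/
def MapsOntoUpTo {K L : Type*} [CommRing K] [CommRing L] [Algebra ℚ K] [Algebra ℚ L]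
    (φ : K ≃ₐ[ℚ] L) (u : Lˣ) (N : Submodule ℤ K) (N' : Submodule ℤ L) : Prop :=
  ∀ x, x ∈ N ↔ (u : L) * φ x ∈ N'

section MapsOntoUpTo

variable {K L : Type*} [CommRing K] [CommRing L] [Algebra ℚ K] [Algebra ℚ L] {φ : K ≃ₐ[ℚ] L}

open Pointwise in
theorem image_eq_smul_iff {κ : Lˣ} {N : Submodule ℤ K} {N' : Submodule ℤ L} :
    φ '' (N : Set K) = (κ : L) • (N' : Set L) ↔ MapsOntoUpTo φ κ⁻¹ N N' := by
  constructor
  · intro h x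
    constructor
    · intro hx
      have : φ x ∈ (κ : L) • (N' : Set L) := h ▸ ⟨x, hx, rfl⟩
      obtain ⟨y, hy, hxy⟩ := this
      rw [← hxy]
      simpa using hy
    · intro hx
      have : φ x ∈ (κ : L) • (N' : Set L) :=
        ⟨_, hx, by simp⟩
      rw [← h] at this
      obtain ⟨y, hy, hxy⟩ := this
      rwa [← φ.injective hxy]
  · intro h
    ext y
    constructor
    · rintro ⟨x, hx, rfl⟩
      exact ⟨_, (h x).1 hx, by simp⟩
    · rintro ⟨z, hz, rfl⟩
      refine ⟨φ.symm ((κ : L) • z), (h _).2 ?_, by simp⟩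
      simpa using hz

open Pointwise in
theorem image_eq_iff {N : Submodule ℤ K} {N' : Submodule ℤ L} :
    φ '' (N : Set K) = (N' : Set L) ↔ MapsOntoUpTo φ 1 N N' := by
  rw [← inv_one, ← image_eq_smul_iff, Units.val_one, one_smul]

theorem MapsOntoUpTo.quotient {N₁ N₂ N₃ : Submodule ℤ K} {N₁' N₂' N₃' : Submodule ℤ L} {u v : Lˣ}
    (h₁ : MapsOntoUpTo φ u N₁ N₁') (h₂ : MapsOntoUpTo φ v N₂ N₂')
    (h₃ : ∀ x, x ∈ N₃ ↔ ∀ y ∈ N₂, x * y ∈ N₁) (h₃' : ∀ x, x ∈ N₃' ↔ ∀ y ∈ N₂', x * y ∈ N₁') :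
    MapsOntoUpTo φ (u * v⁻¹) N₃ N₃' := by
  intro x
  rw [h₃, h₃']
  constructor
  · intro h y hy
    have h2 : φ.symm ((v⁻¹ : Lˣ) * y) ∈ N₂ := (h₂ _).2 (by simpa using hy)
    have := (h₁ _).1 (h _ h2)
    rw [map_mul, AlgEquiv.apply_symm_apply] at this
    convert this using 1
    push_cast
    ring
  · intro h y hy
    rw [h₁]
    convert h _ ((h₂ y).1 hy) using 1
    rw [map_mul, Units.val_mul]
    linear_combination (-(u : L) * φ x * φ y) * v.inv_mul

theorem MapsOntoUpTo.dual {N₁ N₂ : Submodule ℤ K} {N₁' N₂' : Submodule ℤ L} {u v : Lˣ}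
    {θ : K →ₗ[ℚ] ℚ} {θ' : L →ₗ[ℚ] ℚ} (hθ : ∀ x, θ x = θ' (v * φ x))
    (h₁ : MapsOntoUpTo φ u N₁ N₁')
    (h₂ : ∀ x, x ∈ N₂ ↔ ∀ y ∈ N₁, ∃ z : ℤ, θ (x * y) = z)
    (h₂' : ∀ x, x ∈ N₂' ↔ ∀ y ∈ N₁', ∃ z : ℤ, θ' (x * y) = z) :
    MapsOntoUpTo φ (v * u⁻¹) N₂ N₂' := by
  intro x
  rw [h₂, h₂']
  constructor
  · intro h y hy
    have h2 : φ.symm ((u⁻¹ : Lˣ) * y) ∈ N₁ := (h₁ _).2 (by simpa using hy)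
    obtain ⟨z, hz⟩ := h _ h2
    refine ⟨z, ?_⟩
    rw [hθ, map_mul φ, AlgEquiv.apply_symm_apply] at hz
    rw [← hz]
    congr 1
    push_cast
    ring
  · intro h y hy
    obtain ⟨z, hz⟩ := h _ ((h₁ y).1 hy)
    refine ⟨z, ?_⟩
    rw [← hz, hθ]
    congr 1
    rw [map_mul, Units.val_mul]
    linear_combination (-(v : L) * φ x * φ y) * u.inv_mul

end MapsOntoUpTo

theorem exists_dualFunctional_eq_mul {f : ℤ[X]} (hf : f ≠ 0) (hpos : 0 < f.natDegree)
    (τ : Kf f →ₗ[ℚ] ℚ) : ∃ u : Kf f, ∀ x, τ x = dualFunctional f hf hpos (u * x) := by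
  refine ⟨∑ i : Fin f.natDegree, τ (rootOf f ^ (f.natDegree - 1 - i)) • eulerElt f i, fun x => ?_⟩
  conv_lhs => rw [eq_sum_dualFunctional_smul_pow hf hpos x]
  rw [map_sum, Finset.sum_mul, map_sum, ← Equiv.sum_comp Fin.revPerm]
  refine Finset.sum_congr rfl fun i _ => ?_
  rw [map_smul, smul_mul_assoc, map_smul, Fin.revPerm_apply, Fin.val_rev, mul_comm x,
    show f.natDegree - 1 - (f.natDegree - (i + 1)) = i by omega,
    show f.natDegree - 1 - i = f.natDegree - (i + 1) by omega, smul_eq_mul, smul_eq_mul, mul_comm]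

theorem exists_unit_dualFunctional {f g : ℤ[X]} (hf : f ≠ 0) (hfpos : 0 < f.natDegree)
    (hg : g ≠ 0) (hgpos : 0 < g.natDegree) (φ : Kf f ≃ₐ[ℚ] Kf g) :
    ∃ v : (Kf g)ˣ, ∀ x, dualFunctional f hf hfpos x = dualFunctional g hg hgpos (v * φ x) := by
  obtain ⟨v, hv⟩ := exists_dualFunctional_eq_mul hg hgpos
    (dualFunctional f hf hfpos ∘ₗ φ.symm.toLinearMap)
  obtain ⟨w, hw⟩ := exists_dualFunctional_eq_mul hf hfpos
    (dualFunctional g hg hgpos ∘ₗ φ.toLinearMap)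
  have hv' : ∀ x, dualFunctional f hf hfpos x = dualFunctional g hg hgpos (v * φ x) := by
    intro x
    simpa using hv (φ x)
  have hw' : ∀ x, dualFunctional g hg hgpos (φ x) = dualFunctional f hf hfpos (w * x) := hw
  have hone : v * φ w = 1 := by
    rw [← sub_eq_zero]
    refine eq_zero_of_dualFunctional hg hgpos fun y => ?_
    obtain ⟨x, rfl⟩ := φ.surjective y
    rw [sub_mul, map_sub, one_mul, hw', hv', map_mul φ, mul_assoc, sub_self]
  exact ⟨Units.mkOfMulEqOne v _ hone, hv'⟩

/-- The pair (invariant order, invariant ideal up to scaling) and the module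
`ℤ + ℤα + ⋯ + ℤα^(n-1)` up to scaling determine each other. -/
theorem invModule_iff_powModule {f g : ℤ[X]} (hfc : f.content = 1) (hgc : g.content = 1)
    (hfpos : 0 < f.natDegree) (hgpos : 0 < g.natDegree) (φ : Kf f ≃ₐ[ℚ] Kf g) :
    (MapsOntoUpTo φ 1 (invModule f 0) (invModule g 0) ∧
      ∃ κ, MapsOntoUpTo φ κ (invModule f 1) (invModule g 1)) ↔
    ∃ κ, MapsOntoUpTo φ κ (powModule f) (powModule g) := by
  have hf : f ≠ 0 := by rintro rfl; simp at hfpos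
  have hg : g ≠ 0 := by rintro rfl; simp at hgpos
  obtain ⟨v, hv⟩ := exists_unit_dualFunctional hf hfpos hg hgpos φ
  constructor
  · rintro ⟨hR, κ, hI⟩
    exact ⟨_, MapsOntoUpTo.dual hv
      (hR.quotient hI (mem_eulerModule_iff_invModule hfc hfpos)
        (mem_eulerModule_iff_invModule hgc hgpos))
      (mem_powModule_iff hf hfpos) (mem_powModule_iff hg hgpos)⟩
  · rintro ⟨κ, hM⟩
    have hB := MapsOntoUpTo.dual hv hM
      (fun x => by simpa only [mul_comm] using mem_eulerModule_iff hf hfpos x)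
      (fun x => by simpa only [mul_comm] using mem_eulerModule_iff hg hgpos x)
    have hR := hB.quotient hB (mem_invModule_zero_iff hfc hfpos) (mem_invModule_zero_iff hgc hgpos)
    rw [mul_inv_cancel] at hR
    exact ⟨hR, _, hR.quotient hB (mem_invModule_one_iff hfc hfpos)
      (mem_invModule_one_iff hgc hgpos)⟩

theorem nodup_roots_of_discC_ne_zero {f : ℤ[X]} (h : discC f ≠ 0) :
    (f.map (Int.castRingHom ℂ)).roots.Nodup := by
  rw [← Multiset.coe_toList (f.map (Int.castRingHom ℂ)).roots, Multiset.coe_nodup,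
    List.nodup_iff_injective_get]
  have hne := Finset.prod_ne_zero_iff.1 (right_ne_zero_of_mul h)
  have key : ∀ i j : Fin (rootList f).length, i < j →
      (rootList f).get i ≠ (rootList f).get j := by
    intro i j hij heq
    refine hne (i, j) (Finset.mem_univ _) ?_
    rw [if_pos (show ((i, j).1 : ℕ) < (i, j).2 from hij)]
    change ((rootList f).get i - (rootList f).get j) ^ 2 = 0
    rw [heq, sub_self, zero_pow two_ne_zero]
  intro i j hij
  by_contra hne'
  rcases lt_or_gt_of_ne hne' with h | h
  · exact key i j h hij
  · exact key j i h hij.symm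

section Embeddings

variable {n : ℕ} {f : ℤ[X]}

theorem map_rootOf_mem_roots (hf : f ≠ 0) (σ : Kf f →ₐ[ℚ] ℂ) :
    σ (rootOf f) ∈ (f.map (Int.castRingHom ℂ)).roots := by
  rw [mem_roots ((Polynomial.map_ne_zero_iff (RingHom.injective_int _)).2 hf), IsRoot, eval_map,
    eval₂_eq_sum_range]
  simpa using congrArg σ (sum_coeff_mul_rootOf_pow f)

theorem exists_algHom_of_mem_roots {α : ℂ} (hα : α ∈ (f.map (Int.castRingHom ℂ)).roots) :
    ∃ σ : Kf f →ₐ[ℚ] ℂ, σ (rootOf f) = α := by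
  have h : (f.map (Int.castRingHom ℚ)).eval₂ (Algebra.ofId ℚ ℂ : ℚ →+* ℂ) α = 0 := by
    have := isRoot_of_mem_roots hα
    rw [IsRoot, eval_map] at this
    rw [eval₂_map, ← this]
    congr 1
  exact ⟨AdjoinRoot.liftAlgHom _ (Algebra.ofId ℚ ℂ) α h, AdjoinRoot.liftAlgHom_root ..⟩

theorem algHom_ext_rootOf {A : Type*} [CommRing A] [Algebra ℚ A] {σ τ : Kf f →ₐ[ℚ] A}
    (h : σ (rootOf f) = τ (rootOf f)) : σ = τ :=
  AdjoinRoot.algHom_ext h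

theorem card_roots_map_intCast (f : ℤ[X]) :
    Multiset.card (f.map (Int.castRingHom ℂ)).roots = f.natDegree := by
  rw [← natDegree_map_eq_of_injective (RingHom.injective_int (Int.castRingHom ℂ)) f]
  exact (IsAlgClosed.splits _).natDegree_eq_card_roots.symm

theorem exists_equiv_algHom (hf : f ≠ 0) (hn : f.natDegree = n)
    (hnd : (f.map (Int.castRingHom ℂ)).roots.Nodup) :
    Nonempty (Fin n ≃ (Kf f →ₐ[ℚ] ℂ)) := by
  let s : Finset ℂ := ⟨_, hnd⟩
  have hs : s.card = n := (card_roots_map_intCast f).trans hn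
  let F : (Kf f →ₐ[ℚ] ℂ) → s := fun σ => ⟨σ (rootOf f), map_rootOf_mem_roots hf σ⟩
  have hF : Function.Bijective F := by
    refine ⟨fun σ τ h => algHom_ext_rootOf (Subtype.ext_iff.1 h), fun α => ?_⟩
    obtain ⟨σ, hσ⟩ := exists_algHom_of_mem_roots (f := f) α.2
    exact ⟨σ, Subtype.ext hσ⟩
  exact ⟨(s.equivFinOfCardEq hs).symm.trans (Equiv.ofBijective F hF).symm⟩

theorem roots_eq_map_algHom (hf : f ≠ 0) (hnd : (f.map (Int.castRingHom ℂ)).roots.Nodup)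
    (e : Fin n ≃ (Kf f →ₐ[ℚ] ℂ)) :
    (f.map (Int.castRingHom ℂ)).roots =
      (Finset.univ : Finset (Fin n)).val.map fun k => e k (rootOf f) := by
  have hinj : Function.Injective fun k => e k (rootOf f) := fun k l h =>
    e.injective (algHom_ext_rootOf h)
  refine (Multiset.Nodup.ext hnd (Finset.univ.nodup.map hinj)).2 fun α => ?_
  rw [Multiset.mem_map]
  constructor
  · intro hα
    obtain ⟨σ, hσ⟩ := exists_algHom_of_mem_roots hα
    exact ⟨e.symm σ, Finset.mem_univ_val _, by simpa using hσ⟩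
  · rintro ⟨k, _, rfl⟩
    exact map_rootOf_mem_roots hf _

theorem hermiteForm_eq_prod (hf : f ≠ 0) (hnd : (f.map (Int.castRingHom ℂ)).roots.Nodup)
    (e : Fin n ≃ (Kf f →ₐ[ℚ] ℂ)) :
    hermiteForm n f = MvPolynomial.C ((f.leadingCoeff : ℂ) ^ (n - 1)) *
      ∏ k, ∑ j : Fin n, MvPolynomial.C (e k (rootOf f) ^ (n - 1 - (j : ℕ))) *
        MvPolynomial.X j := by
  rw [hermiteForm, roots_eq_map_algHom hf hnd e, Multiset.map_map]
  rfl

/-- The matrix of the conjugates of `α^(n-1), …, α, 1`. -/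
noncomputable def conjMatrix (e : Fin n ≃ (Kf f →ₐ[ℚ] ℂ)) : Matrix (Fin n) (Fin n) ℂ :=
  Matrix.of fun k j => e k (rootOf f ^ (n - 1 - (j : ℕ)))

theorem det_conjMatrix_ne_zero (e : Fin n ≃ (Kf f →ₐ[ℚ] ℂ)) : (conjMatrix e).det ≠ 0 := by
  have h : conjMatrix e = Matrix.projVandermonde 1 fun k => e k (rootOf f) := by
    ext k j
    simp only [conjMatrix, Matrix.of_apply, Matrix.projVandermonde_apply, map_pow, Pi.one_apply,
      one_pow, one_mul, Fin.val_rev]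
    congr 1
    omega
  rw [h, Matrix.det_projVandermonde]
  refine Finset.prod_ne_zero_iff.2 fun i _ => Finset.prod_ne_zero_iff.2 fun j hj => ?_
  rw [Pi.one_apply, Pi.one_apply, one_mul, one_mul, sub_ne_zero]
  intro heq
  exact (Finset.mem_Ioi.1 hj).ne (e.injective (algHom_ext_rootOf heq))

theorem eq_zero_of_forall_algHom (hf : f ≠ 0) (hnd : (f.map (Int.castRingHom ℂ)).roots.Nodup)
    {x : Kf f} (h : ∀ σ : Kf f →ₐ[ℚ] ℂ, σ x = 0) : x = 0 := by
  obtain ⟨e⟩ := exists_equiv_algHom hf rfl hnd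
  have hx := (powBasis f hf).sum_repr x
  set c := (powBasis f hf).repr x
  simp only [powBasis_apply] at hx
  have hc : (fun j : Fin f.natDegree => (c (Fin.rev j) : ℂ)) = 0 := by
    refine Matrix.eq_zero_of_mulVec_eq_zero (det_conjMatrix_ne_zero e) ?_
    ext k
    rw [Pi.zero_apply, ← h (e k), ← hx, map_sum, ← Equiv.sum_comp Fin.revPerm, Matrix.mulVec,
      dotProduct]
    refine Finset.sum_congr rfl fun j _ => ?_
    rw [conjMatrix, Matrix.of_apply, map_smul, Fin.revPerm_apply, Fin.val_rev,
      show f.natDegree - 1 - j = f.natDegree - (j + 1) by omega, mul_comm, Algebra.smul_def]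
    rfl
  rw [← hx]
  refine Finset.sum_eq_zero fun j _ => ?_
  have := congrFun hc (Fin.rev j)
  simp only [Fin.rev_rev, Pi.zero_apply, Rat.cast_eq_zero] at this
  rw [this, zero_smul]

theorem span_range_rootOf_pow_rev (hn : f.natDegree = n) :
    Submodule.span ℤ (Set.range fun j : Fin n => rootOf f ^ (n - 1 - (j : ℕ))) = powModule f := by
  subst hn
  rw [powModule]
  congr 1
  ext x
  constructor
  · rintro ⟨j, rfl⟩
    exact ⟨Fin.rev j, by simp only [Fin.val_rev]; congr 1; omega⟩
  · rintro ⟨j, rfl⟩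
    exact ⟨Fin.rev j, by simp only [Fin.val_rev]; congr 1; omega⟩

/-- The ℤ-basis `ζ_{n-1}, …, ζ₁, 1` of the invariant order. -/
noncomputable def orderBasis (n : ℕ) (f : ℤ[X]) (j : Fin n) : Kf f :=
  if (j : ℕ) = n - 1 then 1 else zeta f (n - 1 - j)

theorem span_range_orderBasis (hn : f.natDegree = n) (hpos : 0 < n) :
    Submodule.span ℤ (Set.range (orderBasis n f)) = invModule f 0 := by
  subst hn
  apply le_antisymm
  · refine Submodule.span_le.2 ?_
    rintro _ ⟨j, rfl⟩
    rw [orderBasis]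
    split_ifs
    · exact one_mem_invModule 0
    · exact zeta_mem_invModule_zero (by omega)
  · refine Submodule.span_le.2 ?_
    rintro x (⟨j, hj, rfl⟩ | ⟨i, hi0, hi, rfl⟩)
    · refine Submodule.subset_span ⟨⟨f.natDegree - 1, by omega⟩, ?_⟩
      rw [orderBasis, if_pos rfl, Nat.le_zero.1 hj, pow_zero]
    · refine Submodule.subset_span ⟨⟨f.natDegree - 1 - i, by omega⟩, ?_⟩
      rw [orderBasis, if_neg (by simp only; omega)]
      congr 1
      simp only
      omega

theorem exists_orderBasis_matrix (hn : f.natDegree = n) (hpos : 0 < n) :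
    ∃ T : Matrix (Fin n) (Fin n) ℤ, T.det = f.leadingCoeff ^ (n - 1) ∧
      ∀ j, orderBasis n f j = ∑ i : Fin n, (T i j : Kf f) * rootOf f ^ (n - 1 - (i : ℕ)) := by
  obtain ⟨m, rfl⟩ : ∃ m, n = m + 1 := ⟨n - 1, by omega⟩
  let T : Matrix (Fin (m + 1)) (Fin (m + 1)) ℤ := Matrix.of fun i j =>
    if (j : ℕ) = m then (if (i : ℕ) = m then 1 else 0)
    else if (j : ℕ) ≤ i ∧ (i : ℕ) < m then f.coeff (m + 1 - (i - j)) else 0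
  refine ⟨T, ?_, fun j => ?_⟩
  · rw [Matrix.det_of_isLowerTriangular, Fin.prod_univ_castSucc]
    · have h1 : ∀ i : Fin m, T i.castSucc i.castSucc = f.leadingCoeff := by
        intro i
        have := i.2
        simp [T, this.ne, leadingCoeff, hn]
      simp [h1]
      simp [T]
    · intro i j hij
      have h : (i : ℕ) < j := hij
      simp only [T, Matrix.of_apply]
      split_ifs <;> first | rfl | omega
  · have hj := j.2
    rw [Nat.add_sub_cancel, orderBasis, Nat.add_sub_cancel]
    split_ifs with h
    · rw [Finset.sum_eq_single (Fin.last m)]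
      · simp [T, h]
      · intro i _ hi
        have : (i : ℕ) ≠ m := fun h' => hi (Fin.ext h')
        simp [T, h, this]
      · simp
    · have hsum : ∑ i : Fin (m + 1), (T i j : Kf f) * rootOf f ^ (m - (i : ℕ)) =
          ∑ i ∈ Finset.range (m + 1), ((if (j : ℕ) ≤ i ∧ i < m then
            f.coeff (m + 1 - (i - j)) else 0 : ℤ) : Kf f) * rootOf f ^ (m - i) := by
        rw [← Fin.sum_univ_eq_sum_range (fun i => ((if (j : ℕ) ≤ i ∧ i < m then
            f.coeff (m + 1 - (i - j)) else 0 : ℤ) : Kf f) * rootOf f ^ (m - i))]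
        simp [T, h]
      rw [hsum, Finset.sum_range_succ]
      obtain ⟨l, hl⟩ : ∃ l, m = j + l := ⟨m - j, by omega⟩
      rw [congrArg Finset.range hl, Finset.sum_range_add, Finset.sum_eq_zero, zero_add, if_neg (by omega), Int.cast_zero,
        zero_mul, add_zero, zeta, hn, show m - j = l by omega]
      · refine Finset.sum_congr rfl fun i hi => ?_
        rw [Finset.mem_range] at hi
        rw [if_pos (by omega), Nat.add_sub_cancel_left, show m - (j + i) = l - i by omega]
      · intro i hi
        rw [Finset.mem_range] at hi
        rw [if_neg (by omega), Int.cast_zero, zero_mul]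

end Embeddings

/-- Two families with the same ℤ-span, one of which has a nonsingular matrix of conjugates, are
related by a unimodular matrix. -/
theorem exists_unimodular_of_span_eq {K : Type*} [CommRing K] {n : ℕ} {v w : Fin n → K}
    (h : Submodule.span ℤ (Set.range w) = Submodule.span ℤ (Set.range v))
    (σ : Fin n → K →+* ℂ) (hdet : (Matrix.of fun k j => σ k (v j)).det ≠ 0) :
    ∃ P : Matrix (Fin n) (Fin n) ℤ, IsUnit P.det ∧ ∀ j, w j = ∑ i, (P i j : K) * v i := by
  have hw : ∀ j, ∃ c : Fin n → ℤ, ∑ i, c i • v i = w j := fun j =>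
    (Submodule.mem_span_range_iff_exists_fun ℤ).1 (h ▸ Submodule.subset_span ⟨j, rfl⟩)
  have hv : ∀ j, ∃ c : Fin n → ℤ, ∑ i, c i • w i = v j := fun j =>
    (Submodule.mem_span_range_iff_exists_fun ℤ).1 (h.symm ▸ Submodule.subset_span ⟨j, rfl⟩)
  choose p hp using hw
  choose q hq using hv
  set A : Matrix (Fin n) (Fin n) ℂ := Matrix.of fun k j => σ k (v j) with hA
  set B : Matrix (Fin n) (Fin n) ℂ := Matrix.of fun k j => σ k (w j) with hB
  set P : Matrix (Fin n) (Fin n) ℤ := Matrix.of fun i j => p j i with hP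
  set Q : Matrix (Fin n) (Fin n) ℤ := Matrix.of fun i j => q j i with hQ
  have hBA : B = A * P.map (Int.castRingHom ℂ) := by
    ext k j
    simp [hA, hB, hP, Matrix.mul_apply, ← hp j, mul_comm]
  have hAB : A = B * Q.map (Int.castRingHom ℂ) := by
    ext k j
    simp [hA, hB, hQ, Matrix.mul_apply, ← hq j, mul_comm]
  refine ⟨P, ?_, fun j => by simp [hP, ← hp j]⟩
  have hPQ : A.det * ((P.det * Q.det : ℤ) : ℂ) = A.det * 1 := by
    conv_rhs => rw [hAB, hBA]
    rw [Matrix.det_mul, Matrix.det_mul, ← RingHom.mapMatrix_apply, ← RingHom.mapMatrix_apply,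
      ← RingHom.map_det, ← RingHom.map_det]
    simp [mul_assoc]
  have := mul_left_cancel₀ hdet hPQ
  exact IsUnit.of_mul_eq_one Q.det (by exact_mod_cast this)

theorem hermiteEquiv_of_mapsOntoUpTo {n : ℕ} {f g : ℤ[X]} (hfn : f.natDegree = n)
    (hgn : g.natDegree = n) (hpos : 0 < n) (hf : f ≠ 0) (hg : g ≠ 0)
    (hfnd : (f.map (Int.castRingHom ℂ)).roots.Nodup)
    (hgnd : (g.map (Int.castRingHom ℂ)).roots.Nodup) {φ : Kf f ≃ₐ[ℚ] Kf g} {κ : (Kf g)ˣ}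
    (hR : MapsOntoUpTo φ 1 (invModule f 0) (invModule g 0))
    (hM : MapsOntoUpTo φ κ (powModule f) (powModule g)) : HermiteEquiv n f g := by
  obtain ⟨e⟩ := exists_equiv_algHom hg hgn hgnd
  let e' : Fin n ≃ (Kf f →ₐ[ℚ] ℂ) := e.trans (φ.symm.arrowCongr AlgEquiv.refl)
  have he' : ∀ k x, e' k x = e k (φ x) := fun k x => rfl
  have hspan : ∀ (κ : (Kf g)ˣ) (N : Submodule ℤ (Kf f)) (N' : Submodule ℤ (Kf g))
      (v : Fin n → Kf f) (w : Fin n → Kf g), MapsOntoUpTo φ κ N N' →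
      Submodule.span ℤ (Set.range v) = N → Submodule.span ℤ (Set.range w) = N' →
      Submodule.span ℤ (Set.range fun j => (κ : Kf g) * φ (v j)) =
        Submodule.span ℤ (Set.range w) := by
    rintro κ N N' v w h rfl rfl
    apply le_antisymm
    · refine Submodule.span_le.2 ?_
      rintro _ ⟨j, rfl⟩
      exact (h _).1 (Submodule.subset_span ⟨j, rfl⟩)
    · intro y hy
      have hx : φ.symm ((κ⁻¹ : (Kf g)ˣ) * y) ∈ Submodule.span ℤ (Set.range v) :=
        (h _).2 (by simpa using hy)
      let L : Kf f →ₗ[ℤ] Kf g :=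
        ((AddMonoidHom.mulLeft (κ : Kf g)).comp (φ : Kf f →+ Kf g)).toIntLinearMap
      have hy' : y = L (φ.symm ((κ⁻¹ : (Kf g)ˣ) * y)) := by
        change y = κ * φ (φ.symm ((κ⁻¹ : (Kf g)ˣ) * y))
        simp
      rw [hy']
      have := Submodule.mem_map_of_mem (f := L) hx
      rw [Submodule.map_span, ← Set.range_comp] at this
      exact this
  have hVg := det_conjMatrix_ne_zero e
  obtain ⟨U, hU, hUv⟩ := exists_unimodular_of_span_eq
    (hspan κ _ _ _ _ hM (span_range_rootOf_pow_rev hfn) (span_range_rootOf_pow_rev hgn))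
    (fun k => (e k : Kf g →+* ℂ)) hVg
  obtain ⟨S, hS, hSr⟩ := exists_orderBasis_matrix hfn hpos
  obtain ⟨T, hT, hTr⟩ := exists_orderBasis_matrix hgn hpos
  have hWg : (Matrix.of fun k j => (e k : Kf g →+* ℂ) (orderBasis n g j)) =
      conjMatrix e * T.map (Int.castRingHom ℂ) := by
    ext k j
    simp [conjMatrix, Matrix.mul_apply, hTr, mul_comm]
  have hWf : (Matrix.of fun k j => e' k (orderBasis n f j)) =
      conjMatrix e' * S.map (Int.castRingHom ℂ) := by
    ext k j
    simp [conjMatrix, Matrix.mul_apply, hSr, mul_comm]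
  have hdet : ∀ A : Matrix (Fin n) (Fin n) ℤ,
      (A.map (Int.castRingHom ℂ)).det = (A.det : ℂ) := fun A =>
    ((Int.castRingHom ℂ).map_det A).symm
  have hgc : (g.leadingCoeff : ℂ) ≠ 0 := by exact_mod_cast leadingCoeff_ne_zero.2 hg
  obtain ⟨P, hP, hPr⟩ := exists_unimodular_of_span_eq
    (hspan 1 _ _ _ _ hR (span_range_orderBasis hfn hpos) (span_range_orderBasis hgn hpos))
    (fun k => (e k : Kf g →+* ℂ)) (by
      rw [hWg, Matrix.det_mul, hdet, hT]
      push_cast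
      exact mul_ne_zero hVg (pow_ne_zero _ hgc))
  have hWP : (Matrix.of fun k j => e' k (orderBasis n f j)) =
      (Matrix.of fun k j => (e k : Kf g →+* ℂ) (orderBasis n g j)) *
        P.map (Int.castRingHom ℂ) := by
    ext k j
    have := congrArg (e k) (hPr j)
    rw [Units.val_one, one_mul] at this
    simp [Matrix.mul_apply, he', this, mul_comm]
  have hUm : Matrix.diagonal (fun k => e k κ) * conjMatrix e' =
      conjMatrix e * U.map (Int.castRingHom ℂ) := by
    ext k j
    have := congrArg (e k) (hUv j)
    rw [map_mul (e k)] at this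
    simp only [Matrix.diagonal_mul, conjMatrix, Matrix.of_apply, he', this]
    simp [Matrix.mul_apply, mul_comm]
  have d1 := congrArg Matrix.det hUm
  have d2 := congrArg Matrix.det (hWf.symm.trans (hWP.trans (congrArg (· * _) hWg)))
  simp only [Matrix.det_mul, hdet, Matrix.det_diagonal, hS, hT, Int.cast_pow] at d1 d2
  have hPP : (P.det : ℂ) * P.det = 1 := by exact_mod_cast Int.isUnit_mul_self hP
  have key : (∏ k, e k κ) * (g.leadingCoeff : ℂ) ^ (n - 1) =
      (U.det * P.det : ℤ) * (f.leadingCoeff : ℂ) ^ (n - 1) := by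
    refine mul_left_cancel₀ hVg ?_
    rw [Int.cast_mul]
    linear_combination (-(P.det : ℂ) * (∏ k, e k κ)) * d2 +
      (P.det : ℂ) * (f.leadingCoeff : ℂ) ^ (n - 1) * d1 -
      ((∏ k, e k κ) * (g.leadingCoeff : ℂ) ^ (n - 1)) * (conjMatrix e).det * hPP
  refine ⟨U, U.det * P.det, hU, Int.isUnit_iff.1 (hU.mul hP), ?_⟩
  rw [hermiteForm_eq_prod hg hgnd e, hermiteForm_eq_prod hf hfnd e', map_mul, map_prod,
    MvPolynomial.bind₁_C_right]
  have hlin : ∀ k, MvPolynomial.bind₁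
      (fun i : Fin n => ∑ j : Fin n, MvPolynomial.C ((U i j : ℂ)) * MvPolynomial.X j)
      (∑ j : Fin n, MvPolynomial.C (e k (rootOf g) ^ (n - 1 - (j : ℕ))) * MvPolynomial.X j) =
      MvPolynomial.C (e k κ) *
        ∑ j : Fin n, MvPolynomial.C (e' k (rootOf f) ^ (n - 1 - (j : ℕ))) * MvPolynomial.X j := by
    intro k
    simp only [map_sum, map_mul, MvPolynomial.bind₁_C_right, MvPolynomial.bind₁_X_right,
      Finset.mul_sum]
    rw [Finset.sum_comm]
    refine Finset.sum_congr rfl fun j _ => ?_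
    have := congrArg (e k) (hUv j)
    simp only [map_mul, map_pow, map_sum, map_intCast] at this
    rw [he', ← mul_assoc, ← map_mul, this, map_sum, Finset.sum_mul]
    refine Finset.sum_congr rfl fun i _ => ?_
    rw [map_mul]
    ring
  simp only [hlin]
  rw [Finset.prod_mul_distrib, ← map_prod, ← mul_assoc, ← map_mul, ← mul_assoc, ← map_mul,
    mul_comm ((g.leadingCoeff : ℂ) ^ (n - 1)), key]

/-- The linear form `v ↦ ∑ⱼ α^(n-1-j) vⱼ`. -/
noncomputable def powForm (n : ℕ) (α : ℂ) : (Fin n → ℂ) →ₗ[ℂ] ℂ :=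
  ∑ j : Fin n, α ^ (n - 1 - (j : ℕ)) • LinearMap.proj j

theorem powForm_apply (n : ℕ) (α : ℂ) (v : Fin n → ℂ) :
    powForm n α v = ∑ j : Fin n, α ^ (n - 1 - (j : ℕ)) * v j := by
  simp [powForm]

theorem powForm_single (n : ℕ) (α : ℂ) (j : Fin n) :
    powForm n α (Pi.single j 1) = α ^ (n - 1 - (j : ℕ)) := by
  simp [powForm_apply, Pi.single_apply]

theorem eval_hermiteForm (n : ℕ) (f : ℤ[X]) (v : Fin n → ℂ) :
    MvPolynomial.eval v (hermiteForm n f) = (f.leadingCoeff : ℂ) ^ (n - 1) *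
      ((f.map (Int.castRingHom ℂ)).roots.map fun α => powForm n α v).prod := by
  rw [hermiteForm, map_mul, MvPolynomial.eval_C, map_multiset_prod, Multiset.map_map]
  simp [powForm_apply]

/-- A linear form whose kernel is covered by the kernels of finitely many linear forms is
proportional to one of them. -/
theorem exists_eq_smul_of_forall_exists_eq_zero {k E : Type*} [Field k] [Infinite k]
    [AddCommGroup E] [Module k E] (ℓ : E →ₗ[k] k) (s : Finset (E →ₗ[k] k))
    (h : ∀ v, ℓ v = 0 → ∃ m ∈ s, m v = 0) : ∃ m ∈ s, ∃ c : k, m = c • ℓ := by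
  let p : s → Subspace k ℓ.ker := fun m => (m : E →ₗ[k] k).ker.comap ℓ.ker.subtype
  have hcov : ⋃ m, (p m : Set ℓ.ker) = Set.univ := by
    refine Set.eq_univ_of_forall fun v => ?_
    obtain ⟨m, hm, hv⟩ := h v v.2
    exact Set.mem_iUnion.2 ⟨⟨m, hm⟩, hv⟩
  obtain ⟨m, hm⟩ := Subspace.exists_eq_top_of_iUnion_eq_univ hcov
  refine ⟨m, m.2, ?_⟩
  have hker : ⨅ _ : Unit, ℓ.ker ≤ (m : E →ₗ[k] k).ker := by
    rw [iInf_const]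
    intro v hv
    have : (⟨v, hv⟩ : ℓ.ker) ∈ p m := hm ▸ Submodule.mem_top
    exact this
  have := mem_span_of_iInf_ker_le_ker (L := fun _ : Unit => ℓ) hker
  rw [Set.range_const, Submodule.mem_span_singleton] at this
  obtain ⟨c, hc⟩ := this
  exact ⟨c, hc.symm⟩

/-- A Hermite equivalence pairs the linear factors of the two forms. -/
theorem exists_root_of_bind₁_eq {n : ℕ} {f g : ℤ[X]} (hf : f ≠ 0)
    {U : Matrix (Fin n) (Fin n) ℤ} {ε : ℤ} (hε : ε ≠ 0)
    (h : MvPolynomial.bind₁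
        (fun i : Fin n => ∑ j : Fin n, MvPolynomial.C ((U i j : ℂ)) * MvPolynomial.X j)
        (hermiteForm n g) = MvPolynomial.C ((ε : ℂ)) * hermiteForm n f)
    {β : ℂ} (hβ : β ∈ (g.map (Int.castRingHom ℂ)).roots) :
    ∃ α ∈ (f.map (Int.castRingHom ℂ)).roots, ∃ c : ℂ, ∀ j : Fin n,
      α ^ (n - 1 - (j : ℕ)) = c * ∑ i : Fin n, (U i j : ℂ) * β ^ (n - 1 - (i : ℕ)) := by
  classical
  let A : Matrix (Fin n) (Fin n) ℂ := U.map (Int.castRingHom ℂ)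
  have hfc : (f.leadingCoeff : ℂ) ≠ 0 := by exact_mod_cast leadingCoeff_ne_zero.2 hf
  have heval : ∀ v : Fin n → ℂ, MvPolynomial.eval (A.mulVec v) (hermiteForm n g) =
      ε * MvPolynomial.eval v (hermiteForm n f) := by
    intro v
    have := congrArg (MvPolynomial.eval v) h
    rw [map_mul, MvPolynomial.eval_C] at this
    rw [← this]
    change _ = MvPolynomial.eval₂Hom (RingHom.id ℂ) v _
    rw [MvPolynomial.eval₂Hom_bind₁]
    change MvPolynomial.eval₂Hom (RingHom.id ℂ) _ _ = _
    congr 2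
    ext i
    simp [A, Matrix.mulVec, dotProduct]
  obtain ⟨m, hm, c, hc⟩ := exists_eq_smul_of_forall_exists_eq_zero
    (powForm n β ∘ₗ A.mulVecLin)
    ((f.map (Int.castRingHom ℂ)).roots.toFinset.image (powForm n)) (by
      intro v hv
      have h0 : MvPolynomial.eval (A.mulVec v) (hermiteForm n g) = 0 := by
        rw [eval_hermiteForm, Multiset.prod_eq_zero, mul_zero]
        exact Multiset.mem_map.2 ⟨β, hβ, hv⟩
      rw [heval, eval_hermiteForm] at h0
      have hε' : (ε : ℂ) ≠ 0 := by exact_mod_cast hε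
      have h1 := (mul_eq_zero.1 ((mul_eq_zero.1 h0).resolve_left hε')).resolve_left
        (pow_ne_zero _ hfc)
      obtain ⟨α, hα, hαv⟩ := Multiset.mem_map.1 (Multiset.prod_eq_zero_iff.1 h1)
      exact ⟨_, Finset.mem_image_of_mem _ (Multiset.mem_toFinset.2 hα), hαv⟩)
  obtain ⟨α, hα, rfl⟩ := Finset.mem_image.1 hm
  refine ⟨α, Multiset.mem_toFinset.1 hα, c, fun j => ?_⟩
  have := LinearMap.congr_fun hc (Pi.single j 1)
  rw [powForm_single] at this
  rw [this]
  simp [powForm_apply, A, mul_comm]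

theorem exists_mapsOntoUpTo_of_hermiteEquiv {n : ℕ} {f g : ℤ[X]} (hfn : f.natDegree = n)
    (hgn : g.natDegree = n) (hn : 2 ≤ n) (hf : f ≠ 0) (hg : g ≠ 0)
    (hgnd : (g.map (Int.castRingHom ℂ)).roots.Nodup) (h : HermiteEquiv n f g) :
    ∃ (φ : Kf f ≃ₐ[ℚ] Kf g) (κ : (Kf g)ˣ), MapsOntoUpTo φ κ (powModule f) (powModule g) := by
  obtain ⟨U, ε, hU, hε, h⟩ := h
  have hε0 : ε ≠ 0 := by rcases hε with rfl | rfl <;> norm_num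
  let q : Fin n → Kf g := fun j => ∑ i : Fin n, (U i j : Kf g) * rootOf g ^ (n - 1 - (i : ℕ))
  have hq : ∀ σ : Kf g →ₐ[ℚ] ℂ, ∃ α ∈ (f.map (Int.castRingHom ℂ)).roots, ∃ c : ℂ, ∀ j : Fin n,
      α ^ (n - 1 - (j : ℕ)) = c * σ (q j) := by
    intro σ
    obtain ⟨α, hα, c, hc⟩ := exists_root_of_bind₁_eq hf hε0 h (map_rootOf_mem_roots hg σ)
    exact ⟨α, hα, c, fun j => by rw [hc]; simp [q]⟩
  let l : Fin n := ⟨n - 1, by omega⟩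
  let l' : Fin n := ⟨n - 2, by omega⟩
  have hl : n - 1 - (l : ℕ) = 0 := Nat.sub_self _
  have hl' : n - 1 - (l' : ℕ) = 1 := by simp only [l']; omega
  have hunit : IsUnit (q l) := by
    have : Module.Finite ℚ (Kf g) := Module.Finite.of_basis (powBasis g hg)
    have : IsArtinianRing (Kf g) := IsArtinianRing.of_finite ℚ _
    refine IsArtinianRing.isUnit_of_mem_nonZeroDivisors (mem_nonZeroDivisors_iff_right.2 ?_)
    intro x hx
    refine eq_zero_of_forall_algHom hg hgnd fun σ => ?_
    obtain ⟨α, _, c, hc⟩ := hq σ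
    have h1 := hc l
    rw [hl, pow_zero] at h1
    have h2 := congrArg σ hx
    rw [map_mul, map_zero] at h2
    exact (mul_eq_zero.1 h2).resolve_right (right_ne_zero_of_mul (h1 ▸ one_ne_zero))
  obtain ⟨κ, hκ⟩ := hunit
  let t : Kf g := q l' * (κ⁻¹ : (Kf g)ˣ)
  have ht : t * q l = q l' := by simp only [t, ← hκ, Units.inv_mul_cancel_right]
  have hσ : ∀ σ : Kf g →ₐ[ℚ] ℂ, σ t ∈ (f.map (Int.castRingHom ℂ)).roots ∧
      ∀ j : Fin n, σ (t ^ (n - 1 - (j : ℕ)) * q l) = σ (q j) := by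
    intro σ
    obtain ⟨α, hα, c, hc⟩ := hq σ
    have h1 := hc l
    rw [hl, pow_zero] at h1
    have h2 := hc l'
    rw [hl', pow_one, ← ht, map_mul] at h2
    have hα' : σ t = α := by linear_combination σ t * h1 - h2
    refine ⟨hα' ▸ hα, fun j => ?_⟩
    have h3 := hc j
    rw [map_mul, map_pow, hα']
    linear_combination σ (q l) * h3 - σ (q j) * h1
  have hpow : ∀ j : Fin n, t ^ (n - 1 - (j : ℕ)) * q l = q j := fun j => by
    rw [← sub_eq_zero]
    refine eq_zero_of_forall_algHom hg hgnd fun σ => ?_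
    rw [map_sub, (hσ σ).2, sub_self]
  have hroot : (f.map (Int.castRingHom ℚ)).eval₂ (Algebra.ofId ℚ (Kf g) : ℚ →+* Kf g) t = 0 := by
    refine eq_zero_of_forall_algHom hg hgnd fun σ => ?_
    have h1 := isRoot_of_mem_roots (hσ σ).1
    rw [IsRoot, eval_map, eval₂_eq_sum_range] at h1
    rw [eval₂_map, eval₂_eq_sum_range, map_sum, ← h1]
    simp
  let φ₀ : Kf f →ₐ[ℚ] Kf g := AdjoinRoot.liftAlgHom _ (Algebra.ofId ℚ (Kf g)) t hroot
  have hφ₀ : φ₀ (rootOf f) = t := AdjoinRoot.liftAlgHom_root ..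
  have hφpow : ∀ j : Fin n, φ₀ (rootOf f ^ (n - 1 - (j : ℕ))) * q l = q j := fun j => by
    rw [map_pow, hφ₀, hpow]
  have hinv : ∀ i : Fin n, ∃ z ∈ powModule f, φ₀ z * q l = rootOf g ^ (n - 1 - (i : ℕ)) := by
    intro i
    refine ⟨∑ j : Fin n, (U⁻¹ j i : Kf f) * rootOf f ^ (n - 1 - (j : ℕ)),
      sum_mem fun j _ => intCast_mul_mem _ _ (rootOf_pow_mem_powModule (by omega)), ?_⟩
    have hterm : ∀ j : Fin n, φ₀ ((U⁻¹ j i : Kf f) * rootOf f ^ (n - 1 - (j : ℕ))) * q l =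
        (U⁻¹ j i : Kf g) * q j := fun j => by rw [map_mul, map_intCast, mul_assoc, hφpow]
    rw [map_sum, Finset.sum_mul]
    simp only [hterm, q, Finset.mul_sum]
    rw [Finset.sum_comm]
    have hmul : ∀ k, ∑ j, (U k j : Kf g) * (U⁻¹ j i : Kf g) = if k = i then 1 else 0 := by
      intro k
      have := congrArg (Int.cast : ℤ → Kf g) (congrFun (congrFun (Matrix.mul_nonsing_inv U hU) k) i)
      simpa [Matrix.mul_apply, Matrix.one_apply] using this
    have hcol : ∀ k : Fin n, ∑ j, (U⁻¹ j i : Kf g) * ((U k j : Kf g) *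
        rootOf g ^ (n - 1 - (k : ℕ))) = if k = i then rootOf g ^ (n - 1 - (k : ℕ)) else 0 := by
      intro k
      rw [← one_mul (rootOf g ^ (n - 1 - (k : ℕ))), ← ite_zero_mul, ← hmul, Finset.sum_mul]
      exact Finset.sum_congr rfl fun j _ => by ring
    simp [hcol]
  have hsurjM : ∀ y ∈ powModule g, ∃ z ∈ powModule f, φ₀ z * q l = y := by
    intro y hy
    rw [← span_range_rootOf_pow_rev hgn] at hy
    induction hy using Submodule.span_induction with
    | mem y hy =>
      obtain ⟨i, rfl⟩ := hy
      exact hinv i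
    | zero => exact ⟨0, zero_mem _, by simp⟩
    | add y y' _ _ hy hy' =>
      obtain ⟨z, hz, rfl⟩ := hy
      obtain ⟨z', hz', rfl⟩ := hy'
      exact ⟨z + z', add_mem hz hz', by rw [map_add, add_mul]⟩
    | smul c y _ hy =>
      obtain ⟨z, hz, rfl⟩ := hy
      exact ⟨c • z, Submodule.smul_mem _ c hz, by rw [map_zsmul, smul_mul_assoc]⟩
  have hsurj : Function.Surjective φ₀ := by
    intro x
    choose z hz hzq using fun j : Fin g.natDegree =>
      hsurjM _ (rootOf_pow_mem_powModule (f := g) j.2)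
    have hy := (powBasis g hg).sum_repr (x * q l)
    simp only [powBasis_apply, ← hzq] at hy
    refine ⟨∑ j, (powBasis g hg).repr (x * q l) j • z j, ?_⟩
    refine κ.mul_left_inj.1 ?_
    rw [hκ, map_sum, Finset.sum_mul]
    refine Eq.trans ?_ hy
    exact Finset.sum_congr rfl fun j _ => by rw [map_smul, smul_mul_assoc]
  have hbij : Function.Bijective φ₀ := by
    refine ⟨?_, hsurj⟩
    have : Module.Finite ℚ (Kf g) := Module.Finite.of_basis (powBasis g hg)
    have : Module.Finite ℚ (Kf f) := Module.Finite.of_basis (powBasis f hf)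
    have hrank : Module.finrank ℚ (Kf f) = Module.finrank ℚ (Kf g) := by
      rw [Module.finrank_eq_card_basis (powBasis f hf),
        Module.finrank_eq_card_basis (powBasis g hg), Fintype.card_fin, Fintype.card_fin, hfn, hgn]
    exact (LinearMap.injective_iff_surjective_of_finrank_eq_finrank
      (f := φ₀.toLinearMap) hrank).2 hsurj
  refine ⟨AlgEquiv.ofBijective φ₀ hbij, κ, fun x => ?_⟩
  rw [AlgEquiv.coe_ofBijective, hκ, mul_comm]
  constructor
  · intro hx
    rw [← span_range_rootOf_pow_rev hfn] at hx
    have hle : Submodule.span ℤ (Set.range fun j : Fin n => rootOf f ^ (n - 1 - (j : ℕ))) ≤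
        (powModule g).comap
          ((AddMonoidHom.mulRight (q l)).comp (φ₀ : Kf f →+ Kf g)).toIntLinearMap := by
      refine Submodule.span_le.2 ?_
      rintro _ ⟨j, rfl⟩
      change φ₀ (rootOf f ^ (n - 1 - (j : ℕ))) * q l ∈ powModule g
      rw [hφpow]
      exact sum_mem fun i _ => intCast_mul_mem _ _ (rootOf_pow_mem_powModule (by omega))
    exact hle hx
  · intro hx
    obtain ⟨z, hz, hzx⟩ := hsurjM _ hx
    rw [← hκ, κ.mul_left_inj] at hzx
    rwa [← hbij.1 hzx]

open Pointwise in
/-- primitive `f, g` (degree `n ≥ 2`, nonzero discriminant) are Hermite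
equivalent iff there are a ℚ-algebra isomorphism `φ : K_f ≃ K_g` and a unit
`κ ∈ K_g^×` with `φ(R_f) = R_g` and `φ(I_f) = κ·I_g`. -/
theorem hermiteEquiv_iff_invIdeal_primitive (n : ℕ) (hn : 2 ≤ n) (f g : Polynomial ℤ)
    (hfn : f.natDegree = n) (hgn : g.natDegree = n)
    (hfprim : f.content = 1) (hgprim : g.content = 1)
    (hdf : discC f ≠ 0) (hdg : discC g ≠ 0) :
    HermiteEquiv n f g ↔
      ∃ (φ : Kf f ≃ₐ[ℚ] Kf g) (κ : (Kf g)ˣ),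
        (φ '' (invModule f 0 : Set (Kf f)) = (invModule g 0 : Set (Kf g))) ∧
        (φ '' (invModule f 1 : Set (Kf f)) =
          (κ : Kf g) • (invModule g 1 : Set (Kf g))) := by
  have hfpos : 0 < f.natDegree := by omega
  have hgpos : 0 < g.natDegree := by omega
  have hf : f ≠ 0 := by rintro rfl; simp at hfpos
  have hg : g ≠ 0 := by rintro rfl; simp at hgpos
  have hfnd := nodup_roots_of_discC_ne_zero hdf
  have hgnd := nodup_roots_of_discC_ne_zero hdg
  simp only [image_eq_iff, image_eq_smul_iff]
  constructor
  · intro h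
    obtain ⟨φ, κ, hM⟩ := exists_mapsOntoUpTo_of_hermiteEquiv hfn hgn hn hf hg hgnd h
    obtain ⟨hR, κ', hI⟩ := (invModule_iff_powModule hfprim hgprim hfpos hgpos φ).2 ⟨κ, hM⟩
    exact ⟨φ, κ'⁻¹, hR, by rwa [inv_inv]⟩
  · rintro ⟨φ, κ, hR, hI⟩
    obtain ⟨κ', hM⟩ := (invModule_iff_powModule hfprim hgprim hfpos hgpos φ).1 ⟨hR, _, hI⟩
    exact hermiteEquiv_of_mapsOntoUpTo hfn hgn (by omega) hf hg hfnd hgnd hR hM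
end
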